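/- Let A be a non-semisimple connected finite-dimensional algebra over a field K, let n ≥ 1, and let M be a finite-dimensional right A-module that is both a generator and a cogenerator of mod-A. Then M is an n-cluster tilting module if and only if the endomorphism algebra B = End_A(M) has global dimension equal to n+1 and dominant dimension equal to n+1. -/

import Mathlib

open CategoryTheory

universe u

section HomologicalDefs

variable (R : Type u) [Ring R]

/-- The `i`-th Ext group of the `R`-modules `M` and `N`, computed in `ModuleCat R`. -/
noncomputable def extGrp (i : ℕ) (M N : ModuleCat.{u} R) : Type u :=
  ((Ext ℤ (ModuleCat.{u} R) i).obj (Opposite.op M)).obj N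

/-- `Ext^i_R(M, N) = 0`. -/
def ExtVanish (i : ℕ) (M N : ModuleCat.{u} R) : Prop :=
  Subsingleton (extGrp R i M N)

/-- `X` lies in `add M`: it is a direct summand of a finite direct sum of copies of `M`. -/
def MemAdd (M X : ModuleCat.{u} R) : Prop :=
  ∃ (k : ℕ) (f : X →ₗ[R] (Fin k → M)) (g : (Fin k → M) →ₗ[R] X),
    g.comp f = LinearMap.id

/-- `M` is an `n`-cluster tilting module for the ring `R`: `M` is a finite module and,
among the finite (= finite-dimensional) `R`-modules `X`, the members of `add M` are exactly
those with `Ext^i(M, X) = 0` for `1 ≤ i ≤ n - 1`, and also exactly those with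
`Ext^i(X, M) = 0` for `1 ≤ i ≤ n - 1`. -/
def IsNClusterTilting (n : ℕ) (M : ModuleCat.{u} R) : Prop :=
  Module.Finite R M ∧
  (∀ X : ModuleCat.{u} R, Module.Finite R X →
    (MemAdd R M X ↔ ∀ i, 1 ≤ i → i ≤ n - 1 → ExtVanish R i M X)) ∧
  (∀ X : ModuleCat.{u} R, Module.Finite R X →
    (MemAdd R M X ↔ ∀ i, 1 ≤ i → i ≤ n - 1 → ExtVanish R i X M))

/-- `X` admits a projective resolution `0 → P_m → ⋯ → P_0 → X → 0` of length at most `m`. -/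
def ProjDimLE (X : ModuleCat.{u} R) (m : ℕ) : Prop :=
  ∃ (P : ℕ → ModuleCat.{u} R) (d : ∀ i, P (i + 1) ⟶ P i) (ε : P 0 ⟶ X),
    (∀ i, i ≤ m → Module.Projective R (P i)) ∧
    (∀ i, m < i → Subsingleton (P i)) ∧
    Function.Surjective ε ∧ Function.Exact (d 0) ε ∧
    (∀ i, Function.Exact (d (i + 1)) (d i))

/-- The projective dimension of the `R`-module `X`, as an extended natural number. -/
noncomputable def projDim (X : ModuleCat.{u} R) : ℕ∞ :=
  sInf {n : ℕ∞ | ∃ m : ℕ, n = (m : ℕ∞) ∧ ProjDimLE R X m}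

/-- The global dimension of the ring `R`: the supremum of the projective dimensions of all
finite (= finite-dimensional) `R`-modules. -/
noncomputable def globalDim : ℕ∞ :=
  ⨆ (X : ModuleCat.{u} R) (_ : Module.Finite R X), projDim R X

/-- There is an exact sequence `0 → R → I_0 → ⋯ → I_{m-1}` of `R`-modules in which every
`I_j` is both projective and injective. -/
def DomDimGE (m : ℕ) : Prop :=
  ∃ (I : ℕ → ModuleCat.{u} R) (f : ModuleCat.of R R ⟶ I 0) (d : ∀ i, I i ⟶ I (i + 1)),
    (∀ i, i < m → Module.Projective R (I i) ∧ Module.Injective R (I i)) ∧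
    (1 ≤ m → Function.Injective f) ∧
    (2 ≤ m → Function.Exact f (d 0)) ∧
    (∀ i, i + 3 ≤ m → Function.Exact (d i) (d (i + 1)))

/-- The dominant dimension of the ring `R`: the supremum of the lengths `m` of exact sequences
`0 → R → I_0 → ⋯ → I_{m-1}` with all `I_j` projective and injective. -/
noncomputable def domDim : ℕ∞ :=
  sSup {n : ℕ∞ | ∃ m : ℕ, n = (m : ℕ∞) ∧ DomDimGE R m}

end HomologicalDefs

theorem extVanish_iff_subsingleton_ext {R : Type u} [Ring R] {X Y : ModuleCat.{u} R} {i : ℕ} (hi : 1 ≤ i) :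
    ExtVanish R i X Y ↔ Subsingleton (Abelian.Ext.{u} X Y i) := by
  obtain ⟨p, rfl⟩ : ∃ p, i = p + 1 := ⟨i - 1, by omega⟩
  let P := ProjectiveResolution.of X
  let C := P.complex.linearYonedaObj ℤ Y
  have h1 : ExtVanish R (p + 1) X Y ↔
      ∀ f : P.complex.X (p + 1) ⟶ Y, P.complex.d (p + 2) (p + 1) ≫ f = 0 →
        ∃ g : P.complex.X p ⟶ Y, P.complex.d (p + 1) p ≫ g = f := by
    have e := P.isoExt (R := ℤ) (p + 1) Y
    have : ExtVanish R (p + 1) X Y ↔ Limits.IsZero (C.homology (p + 1)) := by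
      rw [← e.isZero_iff]
      unfold ExtVanish extGrp
      exact ⟨fun h => ModuleCat.isZero_of_subsingleton _, fun h => ModuleCat.subsingleton_of_isZero h⟩
    rw [this, ← HomologicalComplex.exactAt_iff_isZero_homology,
      C.exactAt_iff' p (p + 1) (p + 2) (by simp) (by simp), ShortComplex.moduleCat_exact_iff]
    exact Iff.rfl
  rw [h1]
  constructor
  · intro h
    refine subsingleton_of_forall_eq 0 fun α => ?_
    obtain ⟨f, hf, rfl⟩ := P.extMk_surjective α (p + 2) rfl
    exact (P.extMk_eq_zero_iff f (p + 2) rfl hf p rfl).2 (h f hf)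
  · intro h f hf
    exact (P.extMk_eq_zero_iff f (p + 2) rfl hf p rfl).1 (Subsingleton.elim _ _)

section ModuleSequences

variable {R : Type u} [Ring R]

/-- `0 → X → Y → Z → 0` is a short exact sequence of modules, phrased on elements. -/
structure IsSES {X Y Z : ModuleCat.{u} R} (f : X ⟶ Y) (g : Y ⟶ Z) : Prop where
  inj : Function.Injective f
  exact : Function.Exact f g
  surj : Function.Surjective g

namespace IsSES

variable {X Y Z : ModuleCat.{u} R} {f : X ⟶ Y} {g : Y ⟶ Z}

theorem zero (h : IsSES f g) : f ≫ g = 0 := by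
  ext x
  exact h.exact.apply_apply_eq_zero x

/-- The short complex attached to a short exact sequence. -/
abbrev complex (h : IsSES f g) : ShortComplex (ModuleCat.{u} R) := ShortComplex.mk f g h.zero

theorem shortExact (h : IsSES f g) : h.complex.ShortExact :=
  ModuleCat.shortComplex_shortExact h.complex h.exact h.inj h.surj

theorem of_surjective (hg : Function.Surjective g) :
    IsSES (ModuleCat.ofHom (LinearMap.ker g.hom).subtype) g where
  inj := Subtype.val_injective
  exact := LinearMap.exact_subtype_ker_map g.hom
  surj := hg

theorem of_injective (hf : Function.Injective f) :
    IsSES f (ModuleCat.ofHom (LinearMap.range f.hom).mkQ) where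
  inj := hf
  exact := LinearMap.exact_map_mkQ_range f.hom
  surj := Submodule.mkQ_surjective _

theorem ext_left_succ (h : IsSES f g) {W : ModuleCat.{u} R} {n : ℕ}
    (hZ : Subsingleton (Abelian.Ext.{u} W Z n)) (hY : Subsingleton (Abelian.Ext.{u} W Y (n + 1))) :
    Subsingleton (Abelian.Ext.{u} W X (n + 1)) := by
  refine subsingleton_of_forall_eq 0 fun α => ?_
  obtain ⟨β, rfl⟩ := Abelian.Ext.covariant_sequence_exact₁ W h.shortExact α
    (Subsingleton.elim (α := Abelian.Ext.{u} W Y (n + 1)) _ _) rfl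
  rw [Subsingleton.elim (α := Abelian.Ext.{u} W Z n) β 0, Abelian.Ext.zero_comp]

theorem ext_right (h : IsSES f g) {W : ModuleCat.{u} R} {n : ℕ}
    (hY : Subsingleton (Abelian.Ext.{u} W Y n)) (hX : Subsingleton (Abelian.Ext.{u} W X (n + 1))) :
    Subsingleton (Abelian.Ext.{u} W Z n) := by
  refine subsingleton_of_forall_eq 0 fun α => ?_
  obtain ⟨β, rfl⟩ := Abelian.Ext.covariant_sequence_exact₃ W h.shortExact α rfl
    (Subsingleton.elim (α := Abelian.Ext.{u} W X (n + 1)) _ _)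
  rw [Subsingleton.elim (α := Abelian.Ext.{u} W Y n) β 0, Abelian.Ext.zero_comp]

theorem ext_left_one (h : IsSES f g) {W : ModuleCat.{u} R}
    (hlift : ∀ φ : W ⟶ Z, ∃ ψ : W ⟶ Y, ψ ≫ g = φ)
    (hY : Subsingleton (Abelian.Ext.{u} W Y 1)) :
    Subsingleton (Abelian.Ext.{u} W X 1) := by
  refine subsingleton_of_forall_eq 0 fun α => ?_
  obtain ⟨β, rfl⟩ := Abelian.Ext.covariant_sequence_exact₁ W h.shortExact α
    (Subsingleton.elim (α := Abelian.Ext.{u} W Y 1) _ _) (zero_add 1)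
  obtain ⟨φ, rfl⟩ := (Abelian.Ext.mk₀_bijective W Z).2 β
  obtain ⟨ψ, rfl⟩ := hlift φ
  rw [← Abelian.Ext.mk₀_comp_mk₀, Abelian.Ext.comp_assoc_of_second_deg_zero]
  have := h.shortExact.comp_extClass
  dsimp at this ⊢
  rw [this, Abelian.Ext.comp_zero]

theorem exists_lift (h : IsSES f g) {W : ModuleCat.{u} R}
    (hX : Subsingleton (Abelian.Ext.{u} W X 1)) (φ : W ⟶ Z) : ∃ ψ : W ⟶ Y, ψ ≫ g = φ := by
  obtain ⟨β, hβ⟩ := Abelian.Ext.covariant_sequence_exact₃ W h.shortExact (Abelian.Ext.mk₀ φ)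
    (zero_add 1) (Subsingleton.elim (α := Abelian.Ext.{u} W X 1) _ _)
  obtain ⟨ψ, rfl⟩ := (Abelian.Ext.mk₀_bijective W Y).2 β
  refine ⟨ψ, ?_⟩
  rw [Abelian.Ext.mk₀_comp_mk₀] at hβ
  exact (Abelian.Ext.mk₀_bijective W Z).1 hβ

theorem projDim_right (h : IsSES f g) {n : ℕ} (hX : HasProjectiveDimensionLE X n)
    (hY : Projective Y) : HasProjectiveDimensionLE Z (n + 1) :=
  (h.shortExact.hasProjectiveDimensionLT_X₃_iff n hY).2 hX

theorem projDim_left (h : IsSES f g) {n : ℕ} (hZ : HasProjectiveDimensionLE Z (n + 1))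
    (hY : Projective Y) : HasProjectiveDimensionLE X n :=
  (h.shortExact.hasProjectiveDimensionLT_X₃_iff n hY).1 hZ

end IsSES

theorem hasProjectiveDimensionLE_mono {X : ModuleCat.{u} R} {m n : ℕ} (hmn : m ≤ n)
    (h : HasProjectiveDimensionLE X m) : HasProjectiveDimensionLE X n :=
  hasProjectiveDimensionLT_of_ge X (m + 1) (n + 1) (by omega)

theorem ProjDimLE.hasProjectiveDimensionLE {X : ModuleCat.{u} R} {m : ℕ} (h : ProjDimLE R X m) :
    HasProjectiveDimensionLE X m := by
  induction m generalizing X with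
  | zero =>
    obtain ⟨P, d, ε, hP, hP0, hε, hdε, hd⟩ := h
    have := hP0 1 one_pos
    have hinj : Function.Injective ε := by
      rw [injective_iff_map_eq_zero]
      intro x hx
      obtain ⟨y, rfl⟩ := (hdε x).1 hx
      rw [Subsingleton.elim y 0, map_zero]
    have := hP 0 le_rfl
    rw [← projective_iff_hasProjectiveDimensionLE_zero]
    have e : P 0 ≃ₗ[R] X := LinearEquiv.ofBijective ε.hom ⟨hinj, hε⟩
    exact Projective.of_iso e.toModuleIso inferInstance
  | succ m ih =>
    obtain ⟨P, d, ε, hP, hP0, hε, hdε, hd⟩ := h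
    have hs := IsSES.of_surjective hε
    have := hP 0 (Nat.zero_le _)
    refine hs.projDim_right (ih ?_) inferInstance
    let ε' : P 1 →ₗ[R] LinearMap.ker ε.hom :=
      (d 0).hom.codRestrict _ fun x => hdε.apply_apply_eq_zero x
    refine ⟨fun i => P (i + 1), fun i => d (i + 1), ModuleCat.ofHom ε', fun i hi => hP _ (by omega),
      fun i hi => hP0 _ (by omega), ?_, ?_, fun i => hd (i + 1)⟩
    · rintro ⟨y, hy⟩
      obtain ⟨x, rfl⟩ := (hdε y).1 hy
      exact ⟨x, rfl⟩
    · intro x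
      refine Iff.trans ?_ (hd 0 x)
      exact Subtype.ext_iff

theorem projDimLE_of_hasProjectiveDimensionLE {X : ModuleCat.{u} R} {m : ℕ}
    (h : HasProjectiveDimensionLE X m) : ProjDimLE R X m := by
  induction m generalizing X with
  | zero =>
    have := (projective_iff_hasProjectiveDimensionLE_zero X).2 h
    refine ⟨fun i => Nat.casesOn i X fun _ => ModuleCat.of R PUnit, fun i => 0, 𝟙 X, ?_, ?_,
      Function.surjective_id, ?_, ?_⟩
    · intro i hi
      obtain rfl : i = 0 := by omega
      exact ModuleCat.projective_of_module_projective X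
    · rintro (_ | i) hi
      · omega
      · exact inferInstanceAs (Subsingleton PUnit)
    · intro x
      exact ⟨fun hx => ⟨0, hx.symm⟩, fun ⟨_, hy⟩ => hy.symm⟩
    · intro i x
      exact ⟨fun _ => ⟨0, rfl⟩, fun _ => rfl⟩
  | succ m ih =>
    let π := Projective.π X
    have hπ : Function.Surjective π := (ModuleCat.epi_iff_surjective π).1 inferInstance
    have hs := IsSES.of_surjective hπ
    obtain ⟨P, d, ε, hP, hP0, hε, hdε, hd⟩ := ih (hs.projDim_left h (Projective.projective_over X))
    refine ⟨fun i => Nat.casesOn i (Projective.over X) P,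
      fun i => Nat.casesOn i (ε ≫ ModuleCat.ofHom (LinearMap.ker π.hom).subtype) d, π, ?_, ?_, hπ,
      ?_, ?_⟩
    · rintro (_ | i) hi
      · exact ModuleCat.projective_of_module_projective _
      · exact hP i (by omega)
    · rintro (_ | i) hi
      · omega
      · exact hP0 i (by omega)
    · intro x
      constructor
      · intro hx
        obtain ⟨y, hy⟩ := hε ⟨x, hx⟩
        exact ⟨y, congrArg Subtype.val hy⟩
      · rintro ⟨y, rfl⟩
        exact (ε y).2
    · rintro (_ | i)
      · intro x
        exact Subtype.ext_iff.symm.trans (hdε x)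
      · exact hd i

theorem projDim_le_iff {X : ModuleCat.{u} R} {m : ℕ} :
    projDim R X ≤ m ↔ HasProjectiveDimensionLE X m := by
  constructor
  · intro h
    have hne : {n : ℕ∞ | ∃ m : ℕ, n = (m : ℕ∞) ∧ ProjDimLE R X m}.Nonempty := by
      by_contra hne
      rw [projDim, Set.not_nonempty_iff_eq_empty.1 hne, sInf_empty] at h
      exact absurd h (by simp)
    obtain ⟨k, hk, hX⟩ := csInf_mem hne
    rw [projDim, hk] at h
    exact hasProjectiveDimensionLE_mono (by exact_mod_cast h) hX.hasProjectiveDimensionLE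
  · intro h
    exact sInf_le ⟨m, rfl, projDimLE_of_hasProjectiveDimensionLE h⟩

theorem globalDim_le_iff {m : ℕ} :
    globalDim R ≤ m ↔
      ∀ X : ModuleCat.{u} R, Module.Finite R X → HasProjectiveDimensionLE X m := by
  simp only [globalDim, iSup_le_iff, projDim_le_iff]

/-- There is an exact sequence `0 → Y → J_0 → ⋯ → J_{m-1}` of modules in which every `J_i` is both
projective and injective, built up one cokernel at a time. -/
def DominantGE (R : Type u) [Ring R] : ℕ → ModuleCat.{u} R → Prop
  | 0, _ => True
  | m + 1, Y => ∃ (J Y' : ModuleCat.{u} R) (f : Y ⟶ J) (g : J ⟶ Y'),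
      Module.Projective R J ∧ Module.Injective R J ∧ IsSES f g ∧ DominantGE R m Y'

theorem dominantGE_iff {Y : ModuleCat.{u} R} {m : ℕ} :
    DominantGE R m Y ↔
      ∃ (I : ℕ → ModuleCat.{u} R) (f : Y ⟶ I 0) (d : ∀ i, I i ⟶ I (i + 1)),
        (∀ i, i < m → Module.Projective R (I i) ∧ Module.Injective R (I i)) ∧
        (1 ≤ m → Function.Injective f) ∧
        (2 ≤ m → Function.Exact f (d 0)) ∧
        (∀ i, i + 3 ≤ m → Function.Exact (d i) (d (i + 1))) := by
  induction m generalizing Y with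
  | zero =>
    exact iff_of_true trivial ⟨fun _ => Y, 𝟙 Y, fun _ => 0, fun i hi => by omega, by omega,
      by omega, fun i hi => by omega⟩
  | succ m ih =>
    constructor
    · rintro ⟨J, Y', f, g, hJ, hJ', hs, hY'⟩
      obtain ⟨I, f', d, hI, h1, h2, h3⟩ := ih.1 hY'
      refine ⟨fun i => Nat.casesOn i J I, f, fun i => Nat.casesOn i (g ≫ f') d, ?_, fun _ => hs.inj,
        fun hm x => ?_, ?_⟩
      · rintro (_ | i) hi
        · exact ⟨hJ, hJ'⟩
        · exact hI i (by omega)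
      · rw [← hs.exact x]
        exact (injective_iff_map_eq_zero' f'.hom).1 (h1 (by omega)) (g x)
      · rintro (_ | i) hi
        · intro x
          refine (h2 (by omega) x).trans ?_
          constructor
          · rintro ⟨y, rfl⟩
            obtain ⟨z, rfl⟩ := hs.surj y
            exact ⟨z, rfl⟩
          · rintro ⟨z, rfl⟩
            exact ⟨g z, rfl⟩
        · exact h3 i (by omega)
    · rintro ⟨I, f, d, hI, h1, h2, h3⟩
      have hs := IsSES.of_injective (h1 (by omega))
      refine ⟨I 0, _, f, _, (hI 0 (by omega)).1, (hI 0 (by omega)).2, hs, ?_⟩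
      rcases m with _ | m
      · trivial
      have hfd := h2 (by omega)
      let f' : (I 0 ⧸ LinearMap.range f.hom) →ₗ[R] I 1 :=
        (LinearMap.range f.hom).liftQ (d 0).hom (by
          rintro _ ⟨x, rfl⟩
          exact hfd.apply_apply_eq_zero x)
      refine ih.2 ⟨fun i => I (i + 1), ModuleCat.ofHom f', fun i => d (i + 1),
        fun i hi => hI _ (by omega), fun _ => ?_, fun hm x => ?_, fun i hi => h3 _ (by omega)⟩
      · refine (injective_iff_map_eq_zero f').2 fun x hx => ?_
        obtain ⟨y, rfl⟩ := Submodule.mkQ_surjective _ x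
        exact (hs.exact y).2 ((hfd y).1 hx)
      · refine (h3 0 (by omega) x).trans ?_
        constructor
        · rintro ⟨z, rfl⟩
          exact ⟨Submodule.mkQ _ z, rfl⟩
        · rintro ⟨y, rfl⟩
          obtain ⟨z, rfl⟩ := Submodule.mkQ_surjective _ y
          exact ⟨z, rfl⟩

theorem domDimGE_iff {m : ℕ} : DomDimGE R m ↔ DominantGE R m (ModuleCat.of R R) :=
  dominantGE_iff.symm

theorem DomDimGE.mono {m k : ℕ} (hkm : k ≤ m) (h : DomDimGE R m) : DomDimGE R k := by
  obtain ⟨I, f, d, hI, h1, h2, h3⟩ := h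
  exact ⟨I, f, d, fun i hi => hI i (by omega), fun hk => h1 (by omega), fun hk => h2 (by omega),
    fun i hi => h3 i (by omega)⟩

theorem le_domDim_iff {m : ℕ} : (m : ℕ∞) ≤ domDim R ↔ DomDimGE R m := by
  constructor
  · intro h
    rcases m with _ | m
    · exact domDimGE_iff.2 trivial
    have hlt : (m : ℕ∞) < domDim R := lt_of_lt_of_le (by exact_mod_cast m.lt_succ_self) h
    obtain ⟨_, ⟨k, rfl, hk⟩, hmk⟩ := lt_sSup_iff.1 hlt
    exact hk.mono (by exact_mod_cast hmk)
  · intro h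
    exact le_sSup ⟨m, rfl, h⟩

/-- `X` is in `add M` when its identity is a finite sum of endomorphisms factoring through `M`. -/
theorem memAdd_iff {M X : ModuleCat.{u} R} :
    MemAdd R M X ↔ ∃ (k : ℕ) (b : Fin k → (X →ₗ[R] M)) (a : Fin k → (M →ₗ[R] X)),
      ∀ x, ∑ j, a j (b j x) = x := by
  constructor
  · rintro ⟨k, f, g, h⟩
    refine ⟨k, fun j => LinearMap.proj j ∘ₗ f,
      fun j => g ∘ₗ LinearMap.single R (fun _ => (M : Type u)) j, fun x => ?_⟩
    have := LinearMap.congr_fun h x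
    simp only [LinearMap.comp_apply, LinearMap.proj_apply, LinearMap.id_apply, ← map_sum] at this ⊢
    convert this using 2
    exact LinearMap.sum_single_apply (fun _ : Fin k => (M : Type u)) (f x)
  · rintro ⟨k, b, a, h⟩
    refine ⟨k, LinearMap.pi b, LinearMap.lsum R _ ℕ a, ?_⟩
    ext x
    simpa using h x

theorem ext_right_of_memAdd {M X W : ModuleCat.{u} R} (hX : MemAdd R M X) {n : ℕ}
    (h : Subsingleton (Abelian.Ext.{u} W M n)) : Subsingleton (Abelian.Ext.{u} W X n) := by
  obtain ⟨k, b, a, hab⟩ := memAdd_iff.1 hX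
  refine subsingleton_of_forall_eq 0 fun α => ?_
  have hid : 𝟙 X = ∑ j, ModuleCat.ofHom (b j) ≫ ModuleCat.ofHom (a j) := by
    ext x
    simp [ModuleCat.hom_sum, hab]
  rw [← Abelian.Ext.comp_mk₀_id α, hid, Abelian.Ext.mk₀_sum, Abelian.Ext.comp_sum]
  refine Finset.sum_eq_zero fun j _ => ?_
  rw [← Abelian.Ext.mk₀_comp_mk₀, ← Abelian.Ext.comp_assoc_of_third_deg_zero,
    Subsingleton.elim (α := Abelian.Ext.{u} W M n) (α.comp _ _) 0, Abelian.Ext.zero_comp]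

theorem ext_left_of_memAdd {M X W : ModuleCat.{u} R} (hX : MemAdd R M X) {n : ℕ}
    (h : Subsingleton (Abelian.Ext.{u} M W n)) : Subsingleton (Abelian.Ext.{u} X W n) := by
  obtain ⟨k, b, a, hab⟩ := memAdd_iff.1 hX
  refine subsingleton_of_forall_eq 0 fun α => ?_
  have hid : 𝟙 X = ∑ j, ModuleCat.ofHom (b j) ≫ ModuleCat.ofHom (a j) := by
    ext x
    simp [ModuleCat.hom_sum, hab]
  rw [← Abelian.Ext.mk₀_id_comp α, hid, Abelian.Ext.mk₀_sum, Abelian.Ext.sum_comp]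
  refine Finset.sum_eq_zero fun j _ => ?_
  rw [← Abelian.Ext.mk₀_comp_mk₀, Abelian.Ext.comp_assoc_of_second_deg_zero,
    Subsingleton.elim (α := Abelian.Ext.{u} M W n) (Abelian.Ext.comp _ α _) 0,
    Abelian.Ext.comp_zero]

theorem memAdd_of_split {M N X : ModuleCat.{u} R} (hN : MemAdd R M N) (s : X ⟶ N) (r : N ⟶ X)
    (h : s ≫ r = 𝟙 X) : MemAdd R M X := by
  obtain ⟨k, f, g, hgf⟩ := hN
  refine ⟨k, f ∘ₗ s.hom, r.hom ∘ₗ g, ?_⟩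
  ext x
  have h1 := LinearMap.congr_fun hgf (s x)
  have h2 := congrArg (fun φ => φ.hom x) h
  simp only [LinearMap.comp_apply, LinearMap.id_apply] at h1 ⊢
  rw [h1]
  exact h2

theorem injective_of_split {N X : ModuleCat.{u} R} (hN : Module.Injective R N) (s : X ⟶ N)
    (r : N ⟶ X) (h : s ≫ r = 𝟙 X) : Module.Injective R X where
  out Y Z _ _ _ _ f hf g := by
    obtain ⟨l, hl⟩ := hN.out f hf (s.hom ∘ₗ g)
    refine ⟨r.hom ∘ₗ l, fun y => ?_⟩
    have h2 := congrArg (fun φ => φ.hom (g y)) h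
    simp only [LinearMap.comp_apply, hl]
    exact h2

end ModuleSequences

section HomFunctor

variable {R : Type u} [Ring R]

theorem moduleInjective_iff (X : ModuleCat.{u} R) : Module.Injective R X ↔ Injective X :=
  Module.injective_iff_injective_object R X

/-- Precomposition makes `Hom(M, X)` a right module over the endomorphism ring of `M`. -/
instance homEndModule (M X : Type u) [AddCommGroup M] [Module R M] [AddCommGroup X] [Module R X] :
    Module (Module.End R M)ᵐᵒᵖ (M →ₗ[R] X) where
  smul b h := h ∘ₗ b.unop
  one_smul _ := rfl
  mul_smul _ _ _ := rfl
  smul_zero _ := rfl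
  smul_add _ _ _ := rfl
  add_smul _ _ h := LinearMap.ext fun _ => map_add h _ _
  zero_smul h := LinearMap.ext fun _ => map_zero h

/-- The right `End(M)`-module `Hom(M, X)`. -/
def homObj (M X : ModuleCat.{u} R) : ModuleCat.{u} (Module.End R M)ᵐᵒᵖ :=
  ModuleCat.of _ (M →ₗ[R] X)

/-- Postcomposition with `f`, as a map of right `End(M)`-modules. -/
def homMap (M : ModuleCat.{u} R) {X Y : ModuleCat.{u} R} (f : X ⟶ Y) : homObj M X ⟶ homObj M Y :=
  ModuleCat.ofHom (X := M →ₗ[R] X) (Y := M →ₗ[R] Y)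
    { toFun := fun h => f.hom ∘ₗ h
      map_add' := fun _ _ => LinearMap.ext fun _ => map_add f.hom _ _
      map_smul' := fun _ _ => rfl }

variable {M : ModuleCat.{u} R}

theorem homMap_apply {X Y : ModuleCat.{u} R} (f : X ⟶ Y) (h : M →ₗ[R] X) (m : M) :
    (show M →ₗ[R] Y from homMap M f h) m = f (h m) := rfl

theorem homMap_comp {X Y Z : ModuleCat.{u} R} (f : X ⟶ Y) (g : Y ⟶ Z) :
    homMap M (f ≫ g) = homMap M f ≫ homMap M g := rfl

theorem homMap_id {X : ModuleCat.{u} R} : homMap M (𝟙 X) = 𝟙 (homObj M X) := rfl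

theorem homMap_injective {X Y : ModuleCat.{u} R} {f : X ⟶ Y} (hf : Function.Injective f) :
    Function.Injective (homMap M f) := fun _ _ h =>
  LinearMap.ext fun m => hf (LinearMap.congr_fun (show f.hom ∘ₗ _ = f.hom ∘ₗ _ from h) m)

theorem homMap_exact {X Y Z : ModuleCat.{u} R} {f : X ⟶ Y} {g : Y ⟶ Z}
    (hf : Function.Injective f) (hfg : Function.Exact f g) :
    Function.Exact (homMap M f) (homMap M g) := by
  intro h
  constructor
  · intro hh
    have hr : ∀ m, (show M →ₗ[R] Y from h) m ∈ LinearMap.range f.hom := fun m =>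
      (hfg _).1 (LinearMap.congr_fun (show g.hom ∘ₗ (show M →ₗ[R] Y from h) = 0 from hh) m)
    refine ⟨(LinearEquiv.ofInjective f.hom hf).symm.toLinearMap ∘ₗ
      (show M →ₗ[R] Y from h).codRestrict _ hr, LinearMap.ext fun m => ?_⟩
    exact congrArg Subtype.val
      ((LinearEquiv.ofInjective f.hom hf).apply_symm_apply ⟨(show M →ₗ[R] Y from h) m, hr m⟩)
  · rintro ⟨k, rfl⟩
    exact LinearMap.ext fun m => hfg.apply_apply_eq_zero _

theorem homMap_isSES {X Y Z : ModuleCat.{u} R} {f : X ⟶ Y} {g : Y ⟶ Z} (h : IsSES f g)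
    (hg : Function.Surjective (homMap M g)) : IsSES (homMap M f) (homMap M g) :=
  ⟨homMap_injective h.inj, homMap_exact h.inj h.exact, hg⟩

theorem homMap_surjective_of_ext {X Y Z : ModuleCat.{u} R} {f : X ⟶ Y} {g : Y ⟶ Z}
    (h : IsSES f g) (hX : Subsingleton (Abelian.Ext.{u} M X 1)) :
    Function.Surjective (homMap M g) := fun φ => by
  obtain ⟨ψ, hψ⟩ := h.exists_lift hX (ModuleCat.ofHom (show M →ₗ[R] Z from φ))
  exact ⟨ψ.hom, congrArg ModuleCat.Hom.hom hψ⟩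

theorem exists_lift_of_homMap_surjective {X Y : ModuleCat.{u} R} {g : X ⟶ Y}
    (hg : Function.Surjective (homMap M g)) (φ : M ⟶ Y) : ∃ ψ : M ⟶ X, ψ ≫ g = φ := by
  obtain ⟨ψ, hψ⟩ := hg φ.hom
  exact ⟨ModuleCat.ofHom ψ, ModuleCat.hom_ext hψ⟩

/-- `Hom(M, M)` is the regular right module. -/
def homSelfEquiv (M : ModuleCat.{u} R) :
    (Module.End R M)ᵐᵒᵖ ≃ₗ[(Module.End R M)ᵐᵒᵖ] homObj M M where
  toFun b := show M →ₗ[R] M from b.unop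
  invFun h := MulOpposite.op (show M →ₗ[R] M from h)
  map_add' _ _ := rfl
  map_smul' _ _ := rfl
  left_inv _ := rfl
  right_inv _ := rfl

theorem projective_homObj_of_memAdd {X : ModuleCat.{u} R} (hX : MemAdd R M X) :
    Module.Projective (Module.End R M)ᵐᵒᵖ (homObj M X) := by
  obtain ⟨k, b, a, hab⟩ := memAdd_iff.1 hX
  refine Module.Projective.of_split
    (M := Fin k → (Module.End R M)ᵐᵒᵖ)
    (LinearMap.pi fun j => (homSelfEquiv M).symm.toLinearMap ∘ₗ (homMap M (ModuleCat.ofHom (b j))).hom)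
    (∑ j, (homMap M (ModuleCat.ofHom (a j))).hom ∘ₗ (homSelfEquiv M).toLinearMap ∘ₗ
      LinearMap.proj j) ?_
  ext h
  refine LinearMap.ext fun m => ?_
  rw [LinearMap.comp_apply, LinearMap.sum_apply]
  refine (LinearMap.sum_apply (M := M) (M₂ := X) _ _ m).trans ?_
  exact hab _

/-- `M` is a generator: the unit of the ring is a finite sum of values of linear maps from `M` to
the regular module. -/
def HasUnitDecomposition (M : ModuleCat.{u} R) : Prop :=
  ∃ (k : ℕ) (p : Fin k → (M →ₗ[R] R)) (v : Fin k → M), ∑ j, p j (v j) = 1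

/-- The map `M → X` sending `m` to `p m • x`. -/
def smulHom (p : M →ₗ[R] R) {X : ModuleCat.{u} R} (x : X) : M →ₗ[R] X :=
  (LinearMap.toSpanSingleton R X x) ∘ₗ p

theorem smulHom_apply (p : M →ₗ[R] R) {X : ModuleCat.{u} R} (x : X) (m : M) :
    smulHom p x m = p m • x := rfl

theorem hasUnitDecomposition_of_memAdd (h : MemAdd R M (ModuleCat.of R R)) :
    HasUnitDecomposition M := by
  obtain ⟨k, b, a, hab⟩ := memAdd_iff.1 h
  exact ⟨k, a, fun j => b j 1, hab 1⟩

namespace HasUnitDecomposition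

variable (hM : HasUnitDecomposition M)
include hM

theorem faithful {X Y : ModuleCat.{u} R} {f g : X ⟶ Y} (h : homMap M f = homMap M g) : f = g := by
  obtain ⟨k, p, v, hpv⟩ := hM
  ext x
  have key : ∀ j, p j (v j) • f x = p j (v j) • g x := fun j => by
    have := LinearMap.congr_fun (show f.hom ∘ₗ smulHom (p j) x = g.hom ∘ₗ smulHom (p j) x from
      congrArg (fun φ => φ.hom (smulHom (p j) x)) h) (v j)
    simpa [smulHom_apply] using this
  have := Finset.sum_congr rfl fun j (_ : j ∈ Finset.univ) => key j
  rwa [← Finset.sum_smul, ← Finset.sum_smul, hpv, one_smul, one_smul] at this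

theorem full {X Y : ModuleCat.{u} R} (φ : homObj M X ⟶ homObj M Y) :
    ∃ f : X ⟶ Y, homMap M f = φ := by
  obtain ⟨k, p, v, hpv⟩ := hM
  let Φ : (M →ₗ[R] X) →ₗ[(Module.End R M)ᵐᵒᵖ] (M →ₗ[R] Y) := φ.hom
  have hΦ : ∀ (h : M →ₗ[R] X) (b : M →ₗ[R] M), Φ (h ∘ₗ b) = Φ h ∘ₗ b := fun h b =>
    Φ.map_smul (MulOpposite.op b) h
  have key : ∀ (h : M →ₗ[R] X) (m : M), ∑ j, Φ (smulHom (p j) (h m)) (v j) = Φ h m := by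
    intro h m
    have h1 : ∀ j, Φ (smulHom (p j) (h m)) = Φ h ∘ₗ smulHom (p j) m := fun j => by
      rw [← hΦ]
      congr 1
      ext y
      simp [smulHom_apply]
    simp only [h1, LinearMap.comp_apply, smulHom_apply, ← map_sum, ← Finset.sum_smul, hpv, one_smul]
  have hsmul : ∀ (r : R) (x : X),
      ∑ j, Φ (smulHom (p j) (r • x)) (v j) = r • ∑ j, Φ (smulHom (p j) x) (v j) := by
    intro r x
    have hx : ∀ j, Φ (smulHom (p j) (r • x)) (v j) =
        ∑ i, Φ (smulHom (p i) x) (p j (v j) • r • v i) := fun j => by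
      have : smulHom (p j) (r • x) =
          ∑ i, smulHom (p i) x ∘ₗ smulHom (p j) (r • v i) := by
        ext y
        simp only [LinearMap.sum_apply, LinearMap.comp_apply, smulHom_apply, map_smul,
          ← Finset.smul_sum, ← Finset.sum_smul, hpv, one_smul]
      rw [this, map_sum, LinearMap.sum_apply]
      simp only [hΦ, LinearMap.comp_apply, smulHom_apply]
    simp only [hx]
    rw [Finset.sum_comm, Finset.smul_sum]
    refine Finset.sum_congr rfl fun i _ => ?_
    rw [← map_sum, ← Finset.sum_smul, hpv, one_smul, map_smul]
  have hadd : ∀ x y : X, ∑ j, Φ (smulHom (p j) (x + y)) (v j) =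
      ∑ j, Φ (smulHom (p j) x) (v j) + ∑ j, Φ (smulHom (p j) y) (v j) := by
    intro x y
    rw [← Finset.sum_add_distrib]
    refine Finset.sum_congr rfl fun j _ => ?_
    have : smulHom (p j) (x + y) = smulHom (p j) x + smulHom (p j) y := by
      ext y
      simp [smulHom_apply]
    rw [this, map_add, LinearMap.add_apply]
  refine ⟨ModuleCat.ofHom
    { toFun := fun x => ∑ j, Φ (smulHom (p j) x) (v j)
      map_add' := hadd
      map_smul' := hsmul }, ?_⟩
  ext h
  exact LinearMap.ext fun m => key h m

theorem surjective_of_homMap {X Y : ModuleCat.{u} R} {g : X ⟶ Y}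
    (hg : Function.Surjective (homMap M g)) : Function.Surjective g := by
  obtain ⟨k, p, v, hpv⟩ := hM
  intro y
  choose h hh using fun j => hg (smulHom (p j) y)
  refine ⟨∑ j, (show M →ₗ[R] X from h j) (v j), ?_⟩
  rw [map_sum]
  have : ∀ j, g ((show M →ₗ[R] X from h j) (v j)) = p j (v j) • y := fun j =>
    LinearMap.congr_fun (show g.hom ∘ₗ (show M →ₗ[R] X from h j) = smulHom (p j) y from hh j) (v j)
  simp only [this, ← Finset.sum_smul, hpv, one_smul]

/-- If `Hom(M, g)` is surjective and `Hom(M, Y)` is projective, then `g` splits. -/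
theorem exists_section {X Y : ModuleCat.{u} R} {g : X ⟶ Y}
    (hg : Function.Surjective (homMap M g))
    (hY : Module.Projective (Module.End R M)ᵐᵒᵖ (homObj M Y)) : ∃ s : Y ⟶ X, s ≫ g = 𝟙 Y := by
  obtain ⟨σ, hσ⟩ := Module.projective_lifting_property (homMap M g).hom LinearMap.id hg
  obtain ⟨s, hs⟩ := hM.full (ModuleCat.ofHom σ)
  refine ⟨s, hM.faithful ?_⟩
  rw [homMap_comp, hs, homMap_id]
  exact ModuleCat.hom_ext hσ

/-- `Hom(M, -)` reflects injectivity of modules. -/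
theorem injective_of_homObj {X : ModuleCat.{u} R}
    (hX : Module.Injective (Module.End R M)ᵐᵒᵖ (homObj M X)) : Module.Injective R X := by
  have hmono : Function.Injective (Injective.ι X) :=
    (ModuleCat.mono_iff_injective _).1 inferInstance
  obtain ⟨ρ, hρ⟩ := hX.out (homMap M (Injective.ι X)).hom (homMap_injective hmono) LinearMap.id
  obtain ⟨r, hr⟩ := hM.full (ModuleCat.ofHom ρ)
  refine injective_of_split ?_ (Injective.ι X) r (hM.faithful ?_)
  · exact (moduleInjective_iff _).2 inferInstance
  · rw [homMap_comp, hr, homMap_id]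
    exact ModuleCat.hom_ext (LinearMap.ext hρ)

end HasUnitDecomposition

end HomFunctor

section InjectiveHomObj

variable {R : Type u} [Ring R] {M : ModuleCat.{u} R}

/-- Right multiplication by `r` on the regular module. -/
abbrev rightMul (r : R) : ModuleCat.of R R ⟶ ModuleCat.of R R :=
  ModuleCat.ofHom (LinearMap.toSpanSingleton R R r)

/-- The module `Hom(Hom(M, R), Z)` over `R`, for a right `End(M)`-module `Z`. -/
def DualHom (M : ModuleCat.{u} R) (Z : Type u) [AddCommGroup Z]
    [Module (Module.End R M)ᵐᵒᵖ Z] : Type u :=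
  (M →ₗ[R] R) →ₗ[(Module.End R M)ᵐᵒᵖ] Z

namespace DualHom

variable (Z : Type u) [AddCommGroup Z] [Module (Module.End R M)ᵐᵒᵖ Z]

instance : AddCommGroup (DualHom M Z) :=
  inferInstanceAs (AddCommGroup ((M →ₗ[R] R) →ₗ[(Module.End R M)ᵐᵒᵖ] Z))

instance : Module R (DualHom M Z) where
  smul r α := LinearMap.comp (show (M →ₗ[R] R) →ₗ[(Module.End R M)ᵐᵒᵖ] Z from α)
    (homMap M (rightMul r)).hom
  one_smul α := LinearMap.ext fun h =>
    congrArg (show (M →ₗ[R] R) →ₗ[(Module.End R M)ᵐᵒᵖ] Z from α)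
      (LinearMap.ext fun m => mul_one (h m))
  mul_smul r s α := LinearMap.ext fun h =>
    congrArg (show (M →ₗ[R] R) →ₗ[(Module.End R M)ᵐᵒᵖ] Z from α)
      (LinearMap.ext fun m => (mul_assoc (h m) r s).symm)
  smul_zero _ := rfl
  smul_add _ _ _ := rfl
  add_smul r s α := LinearMap.ext fun h =>
    (congrArg (show (M →ₗ[R] R) →ₗ[(Module.End R M)ᵐᵒᵖ] Z from α)
      (LinearMap.ext fun m => mul_add (h m) r s)).trans
      (map_add (show (M →ₗ[R] R) →ₗ[(Module.End R M)ᵐᵒᵖ] Z from α) _ _)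
  zero_smul α := LinearMap.ext fun h =>
    (congrArg (show (M →ₗ[R] R) →ₗ[(Module.End R M)ᵐᵒᵖ] Z from α)
      (LinearMap.ext fun m => mul_zero (h m))).trans
      (map_zero (show (M →ₗ[R] R) →ₗ[(Module.End R M)ᵐᵒᵖ] Z from α))

variable {Z}

/-- The element `h ↦ z ∘ (h(-) • m)` of `DualHom M Z`, written as if `Z` consisted of maps
out of `M`. -/
def eval (z : Z) (m : M) : DualHom M Z where
  toFun h := MulOpposite.op (show Module.End R M from smulHom h m) • z
  map_add' h₁ h₂ := by
    rw [← add_smul, ← MulOpposite.op_add]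
    congr 2
    ext x
    exact add_smul (h₁ x) (h₂ x) m
  map_smul' b h := by
    rw [RingHom.id_apply, ← mul_smul]
    rfl

theorem eval_add_right (z : Z) (m m' : M) : eval z (m + m') = eval z m + eval z m' := by
  refine LinearMap.ext fun h => ?_
  refine Eq.trans ?_ (add_smul _ _ z)
  exact congrArg (fun b : Module.End R M => MulOpposite.op b • z)
    (LinearMap.ext fun x => smul_add (h x) m m')

theorem eval_smul_right (z : Z) (r : R) (m : M) : eval z (r • m) = r • eval z m :=
  LinearMap.ext fun h => congrArg (fun b : Module.End R M => MulOpposite.op b • z)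
    (LinearMap.ext fun x => (mul_smul (h x) r m).symm)

theorem eval_add_left (z z' : Z) (m : M) : eval (z + z') m = eval z m + eval z' m :=
  LinearMap.ext fun _ => smul_add _ z z'

theorem eval_smul_left (b : (Module.End R M)ᵐᵒᵖ) (z : Z) (m : M) :
    eval (b • z) m = eval z (b.unop m) := by
  refine LinearMap.ext fun h => (mul_smul _ b z).symm.trans ?_
  exact congrArg (fun b : Module.End R M => MulOpposite.op b • z)
    (LinearMap.ext fun x => map_smul b.unop (h x) m)

end DualHom

/-- If `M` is a generator, `Hom(M, -)` preserves injective modules. -/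
theorem HasUnitDecomposition.injective_homObj (hM : HasUnitDecomposition M) {X : ModuleCat.{u} R}
    (hX : Module.Injective R X) : Module.Injective (Module.End R M)ᵐᵒᵖ (homObj M X) where
  out Y Z _ _ _ _ f hf φ := by
    obtain ⟨k, p, v, hpv⟩ := id hM
    let θ : DualHom M Y → X := fun α =>
      ∑ j, (show M →ₗ[R] X from φ ((show (M →ₗ[R] R) →ₗ[(Module.End R M)ᵐᵒᵖ] Y from α) (p j))) (v j)
    have hθ : ∀ (α : DualHom M Y), ∃ g : ModuleCat.of R R ⟶ X,
        (homMap M g).hom = φ ∘ₗ (show (M →ₗ[R] R) →ₗ[(Module.End R M)ᵐᵒᵖ] Y from α) := fun α => by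
      obtain ⟨g, hg⟩ := hM.full (X := ModuleCat.of R R)
        (ModuleCat.ofHom (φ ∘ₗ (show (M →ₗ[R] R) →ₗ[(Module.End R M)ᵐᵒᵖ] Y from α)))
      exact ⟨g, congrArg ModuleCat.Hom.hom hg⟩
    have hθ' : ∀ (α : DualHom M Y) (g : ModuleCat.of R R ⟶ X),
        (homMap M g).hom = φ ∘ₗ (show (M →ₗ[R] R) →ₗ[(Module.End R M)ᵐᵒᵖ] Y from α) →
        θ α = g.hom (1 : R) := by
      intro α g hg
      rw [← hpv, map_sum]
      refine Finset.sum_congr rfl fun j _ => ?_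
      exact (LinearMap.congr_fun
        (show g.hom ∘ₗ p j = (show M →ₗ[R] X from φ _) from LinearMap.congr_fun hg (p j)) (v j)).symm
    let Θ : DualHom M Y →ₗ[R] X :=
      { toFun := θ
        map_add' := fun α β => by
          rw [← Finset.sum_add_distrib]
          refine Finset.sum_congr rfl fun j _ => ?_
          exact LinearMap.congr_fun (map_add φ _ _) (v j)
        map_smul' := fun r α => by
          obtain ⟨g, hg⟩ := hθ α
          rw [hθ' α g hg, hθ' (r • α) (rightMul r ≫ g)]
          · refine Eq.trans ?_ (map_smul g.hom r (1 : R))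
            exact congrArg g.hom ((one_mul r).trans (mul_one r).symm)
          · refine LinearMap.ext fun h => ?_
            exact LinearMap.congr_fun hg (homMap M (rightMul r) h) }
    let F : DualHom M Y →ₗ[R] DualHom M Z :=
      { toFun := fun α => f ∘ₗ (show (M →ₗ[R] R) →ₗ[(Module.End R M)ᵐᵒᵖ] Y from α)
        map_add' := fun α β => LinearMap.ext fun h => map_add f _ _
        map_smul' := fun r α => rfl }
    have hF : Function.Injective F := fun α β h =>
      LinearMap.ext fun x => hf (LinearMap.congr_fun
        (show f ∘ₗ (show (M →ₗ[R] R) →ₗ[(Module.End R M)ᵐᵒᵖ] Y from α) = f ∘ₗ _ from h) x)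
    obtain ⟨l, hl⟩ := hX.out F hF Θ
    refine ⟨{ toFun := fun z =>
                { toFun := fun m => l (DualHom.eval z m)
                  map_add' := fun m m' => by rw [DualHom.eval_add_right, map_add]
                  map_smul' := fun r m => by
                    rw [DualHom.eval_smul_right, map_smul, RingHom.id_apply] }
              map_add' := fun z z' => LinearMap.ext fun m => by
                refine (congrArg l (DualHom.eval_add_left z z' m)).trans ?_
                exact map_add l _ _
              map_smul' := fun b z => LinearMap.ext fun m =>
                congrArg l (DualHom.eval_smul_left b z m) }, fun y => ?_⟩
    refine LinearMap.ext fun m => ?_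
    have h1 : DualHom.eval (f y) m = F (DualHom.eval y m) :=
      LinearMap.ext fun h => (map_smul f _ y).symm
    refine (congrArg l h1).trans ((hl _).trans ?_)
    have h2 : Θ (DualHom.eval y m) = ∑ j, (show M →ₗ[R] X from φ y) (p j (v j) • m) := by
      change θ _ = _
      refine Finset.sum_congr rfl fun j _ => ?_
      let ψ : Y →ₗ[(Module.End R M)ᵐᵒᵖ] homObj M X := φ
      have h3 : ψ (MulOpposite.op (show Module.End R M from smulHom (p j) m) • y) =
        MulOpposite.op (show Module.End R M from smulHom (p j) m) • ψ y := map_smul ψ _ y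
      exact congrArg (fun h : M →ₗ[R] X => h (v j)) h3
    rw [h2, ← map_sum, ← Finset.sum_smul, hpv, one_smul]

theorem exists_iso_of_exact {R : Type u} [Ring R] {X X' Y Z : ModuleCat.{u} R} {f : X ⟶ Y}
    {f' : X' ⟶ Y} {g : Y ⟶ Z} (hf : Function.Injective f) (hf' : Function.Injective f')
    (h : Function.Exact f g) (h' : Function.Exact f' g) : ∃ e : X ≅ X', e.hom ≫ f' = f := by
  have hr : LinearMap.range f.hom = LinearMap.range f'.hom :=
    (LinearMap.exact_iff.1 h).symm.trans (LinearMap.exact_iff.1 h')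
  refine ⟨((LinearEquiv.ofInjective f.hom hf).trans ((LinearEquiv.ofEq _ _ hr).trans
    (LinearEquiv.ofInjective f'.hom hf').symm)).toModuleIso, ?_⟩
  ext x
  exact congrArg Subtype.val ((LinearEquiv.ofInjective f'.hom hf').apply_symm_apply _)

/-- A free right `End(M)`-module is `Hom(M, -)` of a direct sum of copies of `M`, if `M` is finite. -/
theorem exists_finsuppEquiv (hfin : Module.Finite R M) (ι : Type u) :
    Nonempty ((ι →₀ (Module.End R M)ᵐᵒᵖ) ≃ₗ[(Module.End R M)ᵐᵒᵖ]
      homObj M (ModuleCat.of R (ι →₀ M))) := by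
  let Φ : (ι →₀ (Module.End R M)ᵐᵒᵖ) →ₗ[(Module.End R M)ᵐᵒᵖ] homObj M (ModuleCat.of R (ι →₀ M)) :=
    Finsupp.lsum ℕ fun i => (homMap M (Y := ModuleCat.of R (ι →₀ M))
      (ModuleCat.ofHom (Finsupp.lsingle i))).hom ∘ₗ (homSelfEquiv M).toLinearMap
  have hΦ : ∀ c m i, (show M →ₗ[R] (ι →₀ M) from Φ c) m i = (c i).unop m := by
    intro c m i
    induction c using Finsupp.induction_linear with
    | zero => rw [map_zero]; rfl
    | add c d hc hd =>
      rw [map_add]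
      exact (congrArg₂ (· + ·) hc hd)
    | single j b =>
      have : Φ (Finsupp.single j b) = (homMap M (Y := ModuleCat.of R (ι →₀ M))
        (ModuleCat.ofHom (Finsupp.lsingle j))).hom (homSelfEquiv M b) := by
        simp [Φ]
      rw [this]
      change (Finsupp.single j (b.unop m)) i = _
      classical
      rw [Finsupp.single_apply, Finsupp.single_apply]
      split_ifs <;> rfl
  refine ⟨LinearEquiv.ofBijective Φ ⟨fun c d h => ?_, fun h => ?_⟩⟩
  · ext i
    refine MulOpposite.unop_injective (LinearMap.ext fun m => ?_)
    rw [← hΦ, ← hΦ, h]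
  · classical
    obtain ⟨s, hs⟩ := hfin.fg_top
    let h' : M →ₗ[R] (ι →₀ M) := h
    let S : Finset ι := s.biUnion fun m => (h' m).support
    have hS : ∀ m, h' m ∈ Finsupp.supported M R (S : Set ι) := by
      intro m
      have hle : (⊤ : Submodule R M) ≤ (Finsupp.supported M R (S : Set ι)).comap h' := by
        rw [← hs, Submodule.span_le]
        intro x hx
        rw [SetLike.mem_coe, Submodule.mem_comap, Finsupp.mem_supported]
        exact_mod_cast Finset.subset_biUnion_of_mem (fun m => (h' m).support) hx
      exact hle trivial
    refine ⟨∑ i ∈ S, Finsupp.single i (MulOpposite.op (Finsupp.lapply i ∘ₗ h')), ?_⟩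
    refine LinearMap.ext fun m => Finsupp.ext fun i => ?_
    refine (hΦ _ m i).trans ?_
    rw [Finsupp.finsetSum_apply]
    simp only [Finsupp.single_apply]
    rw [Finset.sum_ite_eq' S i]
    split_ifs with hi
    · rfl
    · have := (Finsupp.mem_supported' R _).1 (hS m) i (by simpa using hi)
      exact this.symm

theorem HasUnitDecomposition.exists_iso_homObj_of_projective (hM : HasUnitDecomposition M)
    (hfin : Module.Finite R M) {J : ModuleCat.{u} (Module.End R M)ᵐᵒᵖ}
    (hJ : Module.Projective (Module.End R M)ᵐᵒᵖ J) :
    ∃ N : ModuleCat.{u} R, Nonempty (J ≅ homObj M N) := by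
  obtain ⟨s, hs⟩ := Module.projective_def'.1 hJ
  obtain ⟨E⟩ := exists_finsuppEquiv hfin J
  let P : ModuleCat.{u} R := ModuleCat.of R (J →₀ M)
  let σ : J ⟶ homObj M P := ModuleCat.ofHom (E.toLinearMap ∘ₗ s)
  let π : homObj M P ⟶ J := ModuleCat.ofHom (Finsupp.linearCombination _ id ∘ₗ E.symm.toLinearMap)
  have hσπ : σ ≫ π = 𝟙 J := by
    ext x
    refine (congrArg (Finsupp.linearCombination _ id) (E.symm_apply_apply (s x))).trans ?_
    exact LinearMap.congr_fun hs x
  obtain ⟨e, he⟩ := hM.full (π ≫ σ)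
  have hee : e ≫ e = e := hM.faithful <| by
    rw [homMap_comp, he, Category.assoc, reassoc_of% hσπ]
  obtain ⟨N, i, r, hir, hri⟩ := IsIdempotentComplete.idempotents_split P e hee
  refine ⟨N, ⟨⟨σ ≫ homMap M r, homMap M i ≫ π, ?_, ?_⟩⟩⟩
  · rw [Category.assoc, ← Category.assoc (homMap M r), ← homMap_comp, hri, he, Category.assoc,
      hσπ, Category.comp_id, hσπ]
  · rw [Category.assoc, ← Category.assoc π, ← he, ← homMap_comp, ← homMap_comp, ← hri,
      Category.assoc, hir, Category.comp_id, hir, homMap_id]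

end InjectiveHomObj

section FiniteDimensionalAlgebra

variable (K : Type u) [Field K] {R : Type u} [Ring R] [Algebra K R] [FiniteDimensional K R]
include K

/-- Over a finite-dimensional algebra, `Hom(M, X)` is Noetherian over the endomorphism ring
of `M`. -/
theorem isNoetherian_homObj {M X : ModuleCat.{u} R} (hM : Module.Finite R M)
    (hX : Module.Finite R X) : IsNoetherian (Module.End R M)ᵐᵒᵖ (homObj M X) := by
  let _ : Module K M := Module.compHom M (algebraMap K R)
  let _ : Module K X := Module.compHom X (algebraMap K R)
  have : IsScalarTower K R M := IsScalarTower.of_algebraMap_smul fun _ _ => rfl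
  have : IsScalarTower K R X := IsScalarTower.of_algebraMap_smul fun _ _ => rfl
  have : SMulCommClass R K M := IsScalarTower.to_smulCommClass'
  have : SMulCommClass R K X := IsScalarTower.to_smulCommClass'
  have : FiniteDimensional K M := Module.Finite.trans R M
  have : FiniteDimensional K X := Module.Finite.trans R X
  have hfin : FiniteDimensional K (M →ₗ[R] X) :=
    FiniteDimensional.of_injective (V₂ := M →ₗ[K] X)
      { toFun := fun h => h.restrictScalars K
        map_add' := fun _ _ => rfl
        map_smul' := fun _ _ => rfl }
      (LinearMap.restrictScalars_injective K)
  have : IsScalarTower K (Module.End R M)ᵐᵒᵖ (M →ₗ[R] X) :=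
    ⟨fun k b h => LinearMap.ext fun m => h.map_smul_of_tower k (b.unop m)⟩
  have hnoeth : IsNoetherian (Module.End R M)ᵐᵒᵖ (M →ₗ[R] X) := isNoetherian_of_tower K inferInstance
  exact hnoeth

theorem isNoetherianRing_end_op {M : ModuleCat.{u} R} (hM : Module.Finite R M) :
    IsNoetherianRing (Module.End R M)ᵐᵒᵖ :=
  have := isNoetherian_homObj K hM hM
  isNoetherian_of_linearEquiv (homSelfEquiv M).symm

theorem exists_injective_embedding_finite {X : ModuleCat.{u} R} (hX : Module.Finite R X) :
    ∃ (I : ModuleCat.{u} R) (f : X ⟶ I), Module.Finite R I ∧ Module.Injective R I ∧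
      Function.Injective f := by
  let φ : K →+* R := algebraMap K R
  let V : ModuleCat.{u} K := (ModuleCat.restrictScalars φ).obj X
  have hVfin : FiniteDimensional K V := by
    let _ : Module K X := Module.compHom X (algebraMap K R)
    have : IsScalarTower K R X := IsScalarTower.of_algebraMap_smul fun _ _ => rfl
    exact Module.Finite.trans (R := K) R X
  have hR : FiniteDimensional K ((ModuleCat.restrictScalars φ).obj (ModuleCat.of R R)) := by
    let e : R ≃ₗ[K] (ModuleCat.restrictScalars φ).obj (ModuleCat.of R R) :=
      { AddEquiv.refl R with map_smul' := fun k x => Algebra.smul_def k x }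
    exact Module.Finite.equiv e
  have hV : Injective V := (moduleInjective_iff V).1 (Module.injective_of_isSemisimpleRing K V)
  let adj := ModuleCat.restrictCoextendScalarsAdj.{u} φ
  have hI : Injective ((ModuleCat.coextendScalars φ).obj V) :=
    Injective.injective_of_adjoint adj V
  refine ⟨(ModuleCat.coextendScalars φ).obj V, adj.unit.app X, ?_, (moduleInjective_iff _).2 hI, ?_⟩
  · let H := (ModuleCat.restrictScalars φ).obj (ModuleCat.of R R) →ₗ[K] V
    have hH : Module.Finite K H := inferInstance
    have : IsScalarTower K R H := ⟨fun k s g => LinearMap.ext fun (t : R) => by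
      refine Eq.trans ?_ (g.map_smul k (t * s : R))
      change g (t * (k • s) : R) = g (φ k * (t * s) : R)
      congr 1
      rw [mul_smul_comm, Algebra.smul_def]⟩
    have : Module.Finite R H := Module.Finite.of_restrictScalars_finite K R H
    exact this
  · intro x y hxy
    have h := LinearMap.congr_fun (congrArg (ModuleCat.CoextendScalars.equiv φ V) hxy) (1 : R)
    have h1 : (1 : R) • x = (1 : R) • y := h
    rwa [one_smul, one_smul] at h1

end FiniteDimensionalAlgebra

section Approximation

variable {R : Type u} [Ring R] {M : ModuleCat.{u} R}

theorem memAdd_pi (M : ModuleCat.{u} R) (k : ℕ) : MemAdd R M (ModuleCat.of R (Fin k → M)) :=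
  ⟨k, LinearMap.id, LinearMap.id, rfl⟩

/-- The map `M ^ k → X` with components `h`. -/
abbrev sumHom {X : ModuleCat.{u} R} {k : ℕ} (h : Fin k → (M →ₗ[R] X)) :
    ModuleCat.of R (Fin k → M) ⟶ X :=
  ModuleCat.ofHom (LinearMap.lsum R (fun _ => (M : Type u)) ℕ h)

theorem exists_approximation (hM : Module.Finite R M) {X : ModuleCat.{u} R}
    (hX : Module.Finite (Module.End R M)ᵐᵒᵖ (homObj M X)) :
    ∃ (N : ModuleCat.{u} R) (g : N ⟶ X), Module.Finite R N ∧ MemAdd R M N ∧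
      Function.Surjective (homMap M g) := by
  obtain ⟨k, h, hh⟩ := Module.Finite.exists_fin (R := (Module.End R M)ᵐᵒᵖ) (M := homObj M X)
  refine ⟨ModuleCat.of R (Fin k → M), sumHom h, inferInstanceAs (Module.Finite R (Fin k → M)),
    memAdd_pi M k, ?_⟩
  have htop : LinearMap.range (homMap M (sumHom h)).hom = ⊤ := by
    rw [eq_top_iff, ← hh, Submodule.span_le]
    rintro _ ⟨j, rfl⟩
    refine ⟨LinearMap.single R (fun _ => (M : Type u)) j, LinearMap.ext fun m => ?_⟩
    refine (homMap_apply (sumHom h) _ m).trans ?_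
    exact LinearMap.lsum_piSingle (R := R) (φ := fun _ => (M : Type u)) (S := ℕ) h j m
  exact LinearMap.range_eq_top.1 htop

end Approximation

section DominantDimension

variable {R : Type u} [Ring R]

theorem DominantGE.of_iso {X Y : ModuleCat.{u} R} (e : X ≅ Y) {m : ℕ} (h : DominantGE R m X) :
    DominantGE R m Y := by
  rcases m with _ | m
  · trivial
  obtain ⟨J, Y', f, g, hJ, hJ', hs, hY'⟩ := h
  refine ⟨J, Y', e.inv ≫ f, g, hJ, hJ', ⟨?_, ?_, hs.surj⟩, hY'⟩
  · exact hs.inj.comp ((ModuleCat.mono_iff_injective e.inv).1 inferInstance)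
  · intro x
    refine (hs.exact x).trans ⟨?_, ?_⟩
    · rintro ⟨y, rfl⟩
      exact ⟨e.hom y, by simp⟩
    · rintro ⟨y, rfl⟩
      exact ⟨e.inv y, rfl⟩

theorem dominantGE_two {Y J J' : ModuleCat.{u} R} {f : Y ⟶ J} {g : J ⟶ J'}
    (hJ : Module.Projective R J) (hJi : Module.Injective R J)
    (hJ' : Module.Projective R J') (hJi' : Module.Injective R J')
    (hf : Function.Injective f) (hfg : Function.Exact f g) : DominantGE R 2 Y := by
  refine dominantGE_iff.2 ⟨fun i => Nat.casesOn i J fun _ => J', f, fun i => Nat.casesOn i g 0, ?_,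
    fun _ => hf, fun _ => hfg, fun i hi => by omega⟩
  rintro (_ | i) _
  · exact ⟨hJ, hJi⟩
  · exact ⟨hJ', hJi'⟩

theorem ext_subsingleton_of_injective {W X : ModuleCat.{u} R} (hX : Module.Injective R X) {i : ℕ}
    (hi : 1 ≤ i) : Subsingleton (Abelian.Ext.{u} W X i) := by
  obtain ⟨i, rfl⟩ := Nat.exists_eq_succ_of_ne_zero (Nat.one_le_iff_ne_zero.1 hi)
  have := (moduleInjective_iff X).1 hX
  exact subsingleton_of_forall_eq 0 fun α => α.eq_zero_of_injective

theorem injective_of_iso {X Y : ModuleCat.{u} R} (e : X ≅ Y) (h : Module.Injective R X) :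
    Module.Injective R Y :=
  injective_of_split h e.inv e.hom e.inv_hom_id

theorem injective_of_memAdd {M X : ModuleCat.{u} R} (hM : Module.Injective R M)
    (hX : MemAdd R M X) : Module.Injective R X := by
  obtain ⟨k, f, g, hgf⟩ := hX
  have hk : Module.Injective R (Fin k → M) := inferInstance
  exact injective_of_split (N := ModuleCat.of R (Fin k → M)) hk (ModuleCat.ofHom f)
    (ModuleCat.ofHom g) (ModuleCat.hom_ext hgf)

theorem projective_iff_projDim_zero {X : ModuleCat.{u} R} :
    HasProjectiveDimensionLE X 0 ↔ Module.Projective R X :=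
  (projective_iff_hasProjectiveDimensionLE_zero X).symm.trans
    (IsProjective.iff_projective X).symm

/-- `Ext^i(X, Y) = 0` for `1 ≤ i ≤ k`. -/
def ExtZero (k : ℕ) (X Y : ModuleCat.{u} R) : Prop :=
  ∀ i, 1 ≤ i → i ≤ k → Subsingleton (Abelian.Ext.{u} X Y i)

namespace HasUnitDecomposition

variable {M : ModuleCat.{u} R} (hM : HasUnitDecomposition M)
include hM

theorem injective_of_homMap {X Y : ModuleCat.{u} R} {f : X ⟶ Y}
    (hf : Function.Injective (homMap M f)) : Function.Injective f := by
  obtain ⟨k, p, v, hpv⟩ := hM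
  refine (injective_iff_map_eq_zero f.hom).2 fun x hx => ?_
  have h0 : ∀ j, smulHom (p j) x = 0 := fun j => (map_eq_zero_iff (homMap M f).hom hf).1 <|
    LinearMap.ext fun m => by
    refine (homMap_apply f (smulHom (p j) x) m).trans ?_
    rw [smulHom_apply, map_smul]
    exact (congrArg _ hx).trans (smul_zero _)
  rw [← one_smul R x, ← hpv, Finset.sum_smul]
  exact Finset.sum_eq_zero fun j _ => LinearMap.congr_fun (h0 j) (v j)

theorem exact_of_homMap {X Y Z : ModuleCat.{u} R} {f : X ⟶ Y} {g : Y ⟶ Z}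
    (h : Function.Exact (homMap M f) (homMap M g)) : Function.Exact f g := by
  have hfg : f ≫ g = 0 := hM.faithful <| ModuleCat.hom_ext <| LinearMap.ext fun x => by
    rw [homMap_comp]
    refine (h.apply_apply_eq_zero x).trans ?_
    exact (LinearMap.ext fun m => rfl : (0 : M →ₗ[R] Z) = _)
  obtain ⟨k, p, v, hpv⟩ := hM
  intro y
  constructor
  · intro hy
    have h0 : ∀ j, homMap M g (smulHom (p j) y) = 0 := fun j => LinearMap.ext fun m => by
      refine (homMap_apply g (smulHom (p j) y) m).trans ?_
      rw [smulHom_apply, map_smul, hy]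
      exact smul_zero _
    choose ψ hψ using fun j => (h _).1 (h0 j)
    refine ⟨∑ j, (show M →ₗ[R] X from ψ j) (v j), ?_⟩
    rw [map_sum]
    have h1 : ∀ j, f ((show M →ₗ[R] X from ψ j) (v j)) = p j (v j) • y := fun j =>
      LinearMap.congr_fun (show f.hom ∘ₗ (show M →ₗ[R] X from ψ j) = smulHom (p j) y from hψ j) (v j)
    simp only [h1, ← Finset.sum_smul, hpv, one_smul]
  · rintro ⟨x, rfl⟩
    exact congrArg (fun φ => φ.hom x) hfg

theorem isSES_of_homMap {X Y Z : ModuleCat.{u} R} {f : X ⟶ Y} {g : Y ⟶ Z}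
    (h : IsSES (homMap M f) (homMap M g)) : IsSES f g :=
  ⟨hM.injective_of_homMap h.inj, hM.exact_of_homMap h.exact, hM.surjective_of_homMap h.surj⟩

/-- A module over `End(M)` of dominant dimension at least two is of the form `Hom(M, W)`. -/
theorem exists_iso_of_dominantGE_two (hfin : Module.Finite R M)
    {Y : ModuleCat.{u} (Module.End R M)ᵐᵒᵖ} {k : ℕ} (h : DominantGE _ (k + 2) Y) :
    ∃ W : ModuleCat.{u} R, Nonempty (Y ≅ homObj M W) := by
  obtain ⟨J, Y', f, g, hJ, -, hs, J', Y'', f', g', hJ', -, hs', -⟩ := h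
  obtain ⟨N, ⟨e⟩⟩ := hM.exists_iso_homObj_of_projective hfin hJ
  obtain ⟨N', ⟨e'⟩⟩ := hM.exists_iso_homObj_of_projective hfin hJ'
  obtain ⟨t, ht⟩ := hM.full (e.inv ≫ g ≫ f' ≫ e'.hom)
  let ι : ModuleCat.of R (LinearMap.ker t.hom) ⟶ N :=
    ModuleCat.ofHom (LinearMap.ker t.hom).subtype
  have hι : Function.Injective ι := Subtype.val_injective
  have hιt : Function.Exact ι t := LinearMap.exact_subtype_ker_map t.hom
  have he : Function.Injective e.hom := (ModuleCat.mono_iff_injective _).1 inferInstance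
  have he' : Function.Injective e'.hom := (ModuleCat.mono_iff_injective _).1 inferInstance
  obtain ⟨i, -⟩ := exists_iso_of_exact (f := f ≫ e.hom) (f' := homMap M ι) (g := homMap M t)
    (he.comp hs.inj) (homMap_injective hι) (by
      intro y
      rw [ht]
      have h1 : (e.inv ≫ g ≫ f' ≫ e'.hom) y = e'.hom (f' (g (e.inv y))) := rfl
      rw [h1, map_eq_zero_iff e'.hom.hom he', map_eq_zero_iff f'.hom hs'.inj, hs.exact (e.inv y)]
      constructor
      · rintro ⟨x, hx⟩
        exact ⟨x, by simp [hx]⟩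
      · rintro ⟨x, rfl⟩
        exact ⟨x, by simp⟩) (homMap_exact hι hιt)
  exact ⟨_, ⟨i⟩⟩

/-- **Müller.** Dominant dimension of `Hom(M, X)` bounds from below the vanishing of
`Ext^i(M, X)`. -/
theorem extZero_of_dominantGE (hfin : Module.Finite R M) {k : ℕ} {X : ModuleCat.{u} R}
    (h : DominantGE _ (k + 2) (homObj M X)) : ExtZero k M X := by
  induction k generalizing X with
  | zero => exact fun i hi hi' => by omega
  | succ k ih =>
    obtain ⟨J, Y, f, g, hJ, hJi, hs, hY⟩ := h
    obtain ⟨N, ⟨e⟩⟩ := hM.exists_iso_homObj_of_projective hfin hJ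
    obtain ⟨W, ⟨e'⟩⟩ := hM.exists_iso_of_dominantGE_two hfin hY
    have hN : Module.Injective R N := hM.injective_of_homObj (injective_of_iso e hJi)
    obtain ⟨a, ha⟩ := hM.full (f ≫ e.hom)
    obtain ⟨b, hb⟩ := hM.full (e.inv ≫ g ≫ e'.hom)
    have he : Function.Injective e.hom := (ModuleCat.mono_iff_injective _).1 inferInstance
    have hes : Function.Surjective e.inv := (ModuleCat.epi_iff_surjective _).1 inferInstance
    have he' : Function.Injective e'.hom := (ModuleCat.mono_iff_injective _).1 inferInstance
    have hes' : Function.Surjective e'.hom := (ModuleCat.epi_iff_surjective _).1 inferInstance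
    have hF : IsSES (homMap M a) (homMap M b) := by
      rw [ha, hb]
      refine ⟨he.comp hs.inj, fun y => ?_, hes'.comp (hs.surj.comp hes)⟩
      have h1 : (e.inv ≫ g ≫ e'.hom) y = e'.hom (g (e.inv y)) := rfl
      rw [h1, map_eq_zero_iff e'.hom.hom he', hs.exact (e.inv y)]
      constructor
      · rintro ⟨x, hx⟩
        exact ⟨x, by simp [hx]⟩
      · rintro ⟨x, rfl⟩
        exact ⟨x, by simp⟩
    have hab := hM.isSES_of_homMap hF
    have hW := ih (hY.of_iso e')
    rintro (_ | _ | i) hi hi'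
    · omega
    · exact hab.ext_left_one (exists_lift_of_homMap_surjective hF.surj)
        (ext_subsingleton_of_injective hN le_rfl)
    · exact hab.ext_left_succ (hW _ (by omega) (by omega))
        (ext_subsingleton_of_injective hN (by omega))

end HasUnitDecomposition

end DominantDimension

section GeneratorCogenerator

variable {R : Type u} [Ring R]

/-- The properties of a finite generator-cogenerator `M` over a finite-dimensional algebra that
are used to compare modules over the algebra with modules over the endomorphism ring of `M`. -/
structure IsGeneratorCogenerator (M : ModuleCat.{u} R) : Prop where
  noetherian : IsNoetherianRing R
  noetherian_end : IsNoetherianRing (Module.End R M)ᵐᵒᵖ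
  finite : Module.Finite R M
  finite_homObj (X : ModuleCat.{u} R) : Module.Finite R X →
    Module.Finite (Module.End R M)ᵐᵒᵖ (homObj M X)
  exists_injective (X : ModuleCat.{u} R) : Module.Finite R X →
    ∃ (I : ModuleCat.{u} R) (f : X ⟶ I), Module.Finite R I ∧ Module.Injective R I ∧
      Function.Injective f
  unit : HasUnitDecomposition M
  memAdd_of_injective (X : ModuleCat.{u} R) : Module.Finite R X → Module.Injective R X →
    MemAdd R M X

namespace IsGeneratorCogenerator

variable {M : ModuleCat.{u} R} (hM : IsGeneratorCogenerator M)
include hM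

theorem exists_approximation_isSES {X : ModuleCat.{u} R} (hX : Module.Finite R X) :
    ∃ (X' N : ModuleCat.{u} R) (f : X' ⟶ N) (g : N ⟶ X), Module.Finite R X' ∧
      MemAdd R M N ∧ IsSES f g ∧ IsSES (homMap M f) (homMap M g) := by
  have := hM.noetherian
  obtain ⟨N, g, hN, hNM, hg⟩ := exists_approximation hM.finite (hM.finite_homObj X hX)
  have hs := IsSES.of_surjective (hM.unit.surjective_of_homMap hg)
  exact ⟨_, N, _, g, inferInstanceAs (Module.Finite R (LinearMap.ker g.hom)), hNM, hs,
    homMap_isSES hs hg⟩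

theorem exists_embedding_isSES {X : ModuleCat.{u} R} (hX : Module.Finite R X) :
    ∃ (I W : ModuleCat.{u} R) (f : X ⟶ I) (g : I ⟶ W), Module.Finite R W ∧
      Module.Injective R I ∧ MemAdd R M I ∧ IsSES f g := by
  obtain ⟨I, f, hI, hIi, hf⟩ := hM.exists_injective X hX
  exact ⟨I, _, f, _, inferInstanceAs (Module.Finite R (I ⧸ LinearMap.range f.hom)), hIi,
    hM.memAdd_of_injective I hI hIi, IsSES.of_injective hf⟩

theorem memAdd_iff_projective {X : ModuleCat.{u} R} (hX : Module.Finite R X) :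
    MemAdd R M X ↔ Module.Projective (Module.End R M)ᵐᵒᵖ (homObj M X) := by
  refine ⟨projective_homObj_of_memAdd, fun h => ?_⟩
  obtain ⟨X', N, f, g, -, hN, -, hs⟩ := hM.exists_approximation_isSES hX
  obtain ⟨s, hs'⟩ := hM.unit.exists_section hs.surj h
  exact memAdd_of_split hN s g hs'

theorem projDim_homObj_le {m : ℕ} (hMM : ExtZero m M M)
    (hadd : ∀ X : ModuleCat.{u} R, Module.Finite R X → ExtZero m M X → MemAdd R M X)
    (k : ℕ) {X : ModuleCat.{u} R} (hX : Module.Finite R X)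
    (hext : ∀ i, 1 ≤ i → i + k ≤ m → Subsingleton (Abelian.Ext.{u} M X i)) :
    HasProjectiveDimensionLE (homObj M X) k := by
  induction k generalizing X with
  | zero =>
    exact projective_iff_projDim_zero.2 (projective_homObj_of_memAdd (hadd X hX hext))
  | succ k ih =>
    obtain ⟨X', N, f, g, hX', hN, hs, hF⟩ := hM.exists_approximation_isSES hX
    have := projective_homObj_of_memAdd hN
    refine hF.projDim_right (ih hX' ?_) inferInstance
    rintro (_ | _ | i) hi hi'
    · omega
    · exact hs.ext_left_one (exists_lift_of_homMap_surjective hF.surj)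
        (ext_right_of_memAdd hN (hMM _ le_rfl (by omega)))
    · exact hs.ext_left_succ (hext _ (by omega) (by omega))
        (ext_right_of_memAdd hN (hMM _ (by omega) (by omega)))

omit hM in
theorem exists_surjective_homObj {Y : ModuleCat.{u} (Module.End R M)ᵐᵒᵖ}
    (hY : Module.Finite (Module.End R M)ᵐᵒᵖ Y) :
    ∃ (N : ModuleCat.{u} R) (p : homObj M N ⟶ Y), MemAdd R M N ∧ Function.Surjective p := by
  obtain ⟨k, y, hy⟩ := Module.Finite.exists_fin (R := (Module.End R M)ᵐᵒᵖ) (M := Y)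
  let N := ModuleCat.of R (Fin k → M)
  let p : homObj M N →ₗ[(Module.End R M)ᵐᵒᵖ] Y := ∑ j,
    LinearMap.toSpanSingleton (Module.End R M)ᵐᵒᵖ Y (y j) ∘ₗ (homSelfEquiv M).symm.toLinearMap ∘ₗ
      (homMap M (X := N) (ModuleCat.ofHom (LinearMap.proj j))).hom
  refine ⟨N, ModuleCat.ofHom p, memAdd_pi M k, ?_⟩
  have htop : LinearMap.range p = ⊤ := by
    rw [eq_top_iff, ← hy, Submodule.span_le]
    rintro _ ⟨j, rfl⟩
    let s : homObj M N := LinearMap.single R (fun _ => (M : Type u)) j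
    refine ⟨s, (LinearMap.sum_apply _ _ s).trans ?_⟩
    rw [Finset.sum_eq_single j]
    · have h1 : (homSelfEquiv M).symm (homMap M (X := N) (ModuleCat.ofHom (LinearMap.proj j)) s) = 1 :=
        MulOpposite.unop_injective (LinearMap.ext fun m => Pi.single_eq_same (M := fun _ => (M : Type u)) j m)
      exact (congrArg (· • y j) h1).trans (one_smul _ _)
    · intro i _ hij
      have h1 : (homSelfEquiv M).symm (homMap M (X := N) (ModuleCat.ofHom (LinearMap.proj i)) s) = 0 :=
        MulOpposite.unop_injective (LinearMap.ext fun m => Pi.single_eq_of_ne (M := fun _ => (M : Type u)) hij m)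
      exact (congrArg (· • y i) h1).trans (zero_smul _ _)
    · exact fun h => absurd (Finset.mem_univ j) h
  exact LinearMap.range_eq_top.1 htop

theorem projDim_le_add_two {m : ℕ}
    (h : ∀ X : ModuleCat.{u} R, Module.Finite R X → HasProjectiveDimensionLE (homObj M X) m)
    {Y : ModuleCat.{u} (Module.End R M)ᵐᵒᵖ} (hY : Module.Finite (Module.End R M)ᵐᵒᵖ Y) :
    HasProjectiveDimensionLE Y (m + 2) := by
  have := hM.noetherian
  have := hM.noetherian_end
  have hfinite : ∀ {N : ModuleCat.{u} R}, MemAdd R M N → Module.Finite R N := by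
    rintro N ⟨k, f, g, hgf⟩
    have := hM.finite
    exact Module.Finite.of_surjective g fun x => ⟨f x, LinearMap.congr_fun hgf x⟩
  obtain ⟨N, p, hN, hp⟩ := exists_surjective_homObj hY
  have hs := IsSES.of_surjective hp
  have := hM.finite_homObj N (hfinite hN)
  obtain ⟨N', q, hN', hq⟩ := exists_surjective_homObj
    (Y := ModuleCat.of _ (LinearMap.ker p.hom)) (M := M)
    (inferInstanceAs (Module.Finite _ (LinearMap.ker p.hom)))
  obtain ⟨t, ht⟩ := hM.unit.full (q ≫ ModuleCat.ofHom (LinearMap.ker p.hom).subtype)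
  let ι : ModuleCat.of R (LinearMap.ker t.hom) ⟶ N' :=
    ModuleCat.ofHom (LinearMap.ker t.hom).subtype
  have hι : Function.Injective ι := Subtype.val_injective
  have hιt : Function.Exact ι t := LinearMap.exact_subtype_ker_map t.hom
  have hq' : IsSES (homMap M ι) q := by
    refine ⟨homMap_injective hι, fun x => ?_, hq⟩
    rw [← homMap_exact hι hιt x, ht]
    exact Subtype.ext_iff
  have := projective_homObj_of_memAdd hN
  have := projective_homObj_of_memAdd hN'
  have := hfinite hN'
  exact hs.projDim_right (hq'.projDim_right
    (h _ (inferInstanceAs (Module.Finite R (LinearMap.ker t.hom)))) inferInstance) inferInstance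

theorem dominantGE_homObj {k : ℕ} {X : ModuleCat.{u} R} (hX : Module.Finite R X)
    (hext : ExtZero k M X) : DominantGE _ (k + 2) (homObj M X) := by
  induction k generalizing X with
  | zero =>
    obtain ⟨I, W, f, g, hW, hI, hIM, hs⟩ := hM.exists_embedding_isSES hX
    obtain ⟨I', W', f', g', -, hI', hIM', hs'⟩ := hM.exists_embedding_isSES hW
    refine dominantGE_two (projective_homObj_of_memAdd hIM) (hM.unit.injective_homObj hI)
      (projective_homObj_of_memAdd hIM') (hM.unit.injective_homObj hI') (homMap_injective hs.inj)
      (homMap_exact (g := g ≫ f') hs.inj fun x => ?_)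
    rw [← hs.exact x]
    exact map_eq_zero_iff f'.hom hs'.inj
  | succ k ih =>
    obtain ⟨I, W, f, g, hW, hI, hIM, hs⟩ := hM.exists_embedding_isSES hX
    refine ⟨homObj M I, homObj M W, homMap M f, homMap M g, projective_homObj_of_memAdd hIM,
      hM.unit.injective_homObj hI,
      homMap_isSES hs (homMap_surjective_of_ext hs (hext 1 le_rfl (by omega))), ih hW ?_⟩
    exact fun i hi hi' => hs.ext_right (ext_subsingleton_of_injective hI hi)
      (hext _ (by omega) (by omega))

section ProjDim

variable {d : ℕ} (hd : ∀ Y : ModuleCat.{u} (Module.End R M)ᵐᵒᵖ,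
  Module.Finite (Module.End R M)ᵐᵒᵖ Y → HasProjectiveDimensionLE Y d)
include hd

/-- The cokernel of `Hom(M, X) → Hom(M, I)`, for an injective module `I` containing `X`, has
projective dimension smaller than the global dimension. -/
theorem exists_cokernel_projDim_le {e : ℕ} (hde : d ≤ e + 1) {X I W : ModuleCat.{u} R}
    {f : X ⟶ I} {g : I ⟶ W} (hs : IsSES f g) (hW : Module.Finite R W) :
    ∃ (Q : ModuleCat.{u} (Module.End R M)ᵐᵒᵖ) (q : homObj M I ⟶ Q), IsSES (homMap M f) q ∧
      HasProjectiveDimensionLE Q e := by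
  obtain ⟨I', W', f', g', -, hI', hIM', hs'⟩ := hM.exists_embedding_isSES hW
  have hF := homMap_injective (M := M) hs.inj
  refine ⟨_, _, IsSES.of_injective hF, ?_⟩
  let t := homMap M (g ≫ f')
  have hft : Function.Exact (homMap M f) t := homMap_exact (g := g ≫ f') hs.inj fun x => by
    rw [← hs.exact x]
    exact map_eq_zero_iff f'.hom hs'.inj
  let r : (homObj M I ⧸ LinearMap.range (homMap M f).hom) →ₗ[(Module.End R M)ᵐᵒᵖ] homObj M I' :=
    (LinearMap.range (homMap M f).hom).liftQ t.hom (by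
      rintro _ ⟨x, rfl⟩
      exact hft.apply_apply_eq_zero x)
  have hr : Function.Injective (ModuleCat.ofHom r) := by
    refine (injective_iff_map_eq_zero r).2 fun x hx => ?_
    obtain ⟨y, rfl⟩ := Submodule.mkQ_surjective _ x
    exact ((IsSES.of_injective hF).exact y).2 ((hft y).1 hx)
  have hrs := IsSES.of_injective hr
  have := projective_homObj_of_memAdd hIM'
  have hfin : Module.Finite (Module.End R M)ᵐᵒᵖ (homObj M I') := by
    obtain ⟨k, a, b, hab⟩ := hIM'
    have := hM.finite
    exact hM.finite_homObj I'
      (Module.Finite.of_surjective b fun x => ⟨a x, LinearMap.congr_fun hab x⟩)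
  exact hrs.projDim_left (hasProjectiveDimensionLE_mono hde (hd _
    (inferInstanceAs (Module.Finite _ (homObj M I' ⧸ LinearMap.range r))))) inferInstance

theorem projDim_homObj_le_of_extZero {k e : ℕ} (hde : d ≤ e + k + 2) {X : ModuleCat.{u} R}
    (hX : Module.Finite R X) (hext : ExtZero k M X) :
    HasProjectiveDimensionLE (homObj M X) e := by
  obtain ⟨I, W, f, g, hW, hI, hIM, hs⟩ := hM.exists_embedding_isSES hX
  have := projective_homObj_of_memAdd hIM
  induction k generalizing X e I W with
  | zero =>
    obtain ⟨Q, q, hq, hQ⟩ := hM.exists_cokernel_projDim_le hd (e := e + 1) hde hs hW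
    exact hq.projDim_left hQ inferInstance
  | succ k ih =>
    have hF := homMap_isSES hs (homMap_surjective_of_ext hs (hext 1 le_rfl (by omega)))
    refine hF.projDim_left ?_ inferInstance
    obtain ⟨I', W', f', g', hW', hI', hIM', hs'⟩ := hM.exists_embedding_isSES hW
    exact ih (e := e + 1) (by omega) hW (fun i hi hi' =>
      hs.ext_right (ext_subsingleton_of_injective hI hi) (hext _ (by omega) (by omega)))
      I' W' f' g' hW' hI' hIM' hs' (projective_homObj_of_memAdd hIM')

/-- If the global dimension of the endomorphism ring is too small, then `M` is injective. -/
theorem injective_of_extZero {k : ℕ} (hdk : d ≤ k + 1) (hext : ExtZero k M M) :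
    Module.Injective R M := by
  obtain ⟨I, W, f, g, hW, hI, hIM, hs⟩ := hM.exists_embedding_isSES hM.finite
  obtain ⟨Q, q, hq, hQ⟩ : ∃ (Q : ModuleCat.{u} (Module.End R M)ᵐᵒᵖ) (q : homObj M I ⟶ Q),
      IsSES (homMap M f) q ∧ HasProjectiveDimensionLE Q 0 := by
    rcases k with _ | k
    · exact hM.exists_cokernel_projDim_le hd hdk hs hW
    · refine ⟨_, _, homMap_isSES hs (homMap_surjective_of_ext hs (hext 1 le_rfl (by omega))), ?_⟩
      exact hM.projDim_homObj_le_of_extZero hd (k := k) (by omega) hW fun i hi hi' =>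
        hs.ext_right (ext_subsingleton_of_injective hI hi) (hext _ (by omega) (by omega))
  have hQ' : Projective Q := (projective_iff_hasProjectiveDimensionLE_zero Q).2 hQ
  have hsplit := hq.shortExact.splittingOfProjective
  obtain ⟨r, hr⟩ := hM.unit.full hsplit.r
  refine injective_of_split hI f r (hM.unit.faithful ?_)
  rw [homMap_comp, hr, homMap_id]
  exact hsplit.f_r

end ProjDim

theorem memAdd_of_injective_of_projDim_le (hMi : Module.Injective R M) {e : ℕ}
    {X : ModuleCat.{u} R} (hX : Module.Finite R X)
    (h : HasProjectiveDimensionLE (homObj M X) e) : MemAdd R M X := by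
  induction e generalizing X with
  | zero => exact (hM.memAdd_iff_projective hX).2 (projective_iff_projDim_zero.1 h)
  | succ e ih =>
    obtain ⟨X', N, f, g, hX', hN, hs, hF⟩ := hM.exists_approximation_isSES hX
    have := projective_homObj_of_memAdd hN
    have hX'M := ih hX' (hF.projDim_left h inferInstance)
    obtain ⟨s, hs'⟩ := hs.exists_lift
      (ext_subsingleton_of_injective (injective_of_memAdd hMi hX'M) le_rfl) (𝟙 X)
    exact memAdd_of_split hN s g hs'

theorem isSemisimpleRing_of_injective (hMi : Module.Injective R M) {e : ℕ}
    (h : ∀ X : ModuleCat.{u} R, Module.Finite R X → HasProjectiveDimensionLE (homObj M X) e) :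
    IsSemisimpleRing R := by
  have := hM.noetherian
  refine (isSemisimpleModule_iff R R).2 ⟨fun I => ?_⟩
  have hI : Module.Injective R I := injective_of_memAdd (X := ModuleCat.of R I) hMi
    (hM.memAdd_of_injective_of_projDim_le hMi (inferInstanceAs (Module.Finite R I)) (h _
      (inferInstanceAs (Module.Finite R I))))
  obtain ⟨r, hr⟩ := hI.out I.subtype Subtype.val_injective LinearMap.id
  exact ⟨LinearMap.ker r, LinearMap.isCompl_of_proj hr⟩

theorem isSemisimpleRing_of_extZero {d k : ℕ}
    (hd : ∀ Y : ModuleCat.{u} (Module.End R M)ᵐᵒᵖ,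
      Module.Finite (Module.End R M)ᵐᵒᵖ Y → HasProjectiveDimensionLE Y d)
    (hdk : d ≤ k + 1) (hext : ExtZero k M M) : IsSemisimpleRing R :=
  hM.isSemisimpleRing_of_injective (hM.injective_of_extZero hd hdk hext) fun X hX =>
    hd _ (hM.finite_homObj X hX)

end IsGeneratorCogenerator

end GeneratorCogenerator

section ClusterTilting

variable {R : Type u} [Ring R]

theorem extZero_iff {m : ℕ} {X Y : ModuleCat.{u} R} :
    ExtZero m X Y ↔ ∀ i, 1 ≤ i → i ≤ m → ExtVanish R i X Y :=
  forall₂_congr fun _ hi => imp_congr_right fun _ => (extVanish_iff_subsingleton_ext hi).symm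

theorem isNClusterTilting_succ_iff {m : ℕ} {M : ModuleCat.{u} R} :
    IsNClusterTilting R (m + 1) M ↔ Module.Finite R M ∧
      (∀ X : ModuleCat.{u} R, Module.Finite R X → (MemAdd R M X ↔ ExtZero m M X)) ∧
      (∀ X : ModuleCat.{u} R, Module.Finite R X → (MemAdd R M X ↔ ExtZero m X M)) := by
  simp only [extZero_iff]
  rfl

theorem domDimGE_end_iff {M : ModuleCat.{u} R} {m : ℕ} :
    DomDimGE (Module.End R M)ᵐᵒᵖ m ↔ DominantGE _ m (homObj M M) :=
  domDimGE_iff.trans ⟨DominantGE.of_iso (homSelfEquiv M).toModuleIso,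
    DominantGE.of_iso (homSelfEquiv M).toModuleIso.symm⟩

namespace IsGeneratorCogenerator

variable {M : ModuleCat.{u} R} (hM : IsGeneratorCogenerator M)
include hM

theorem memAdd_of_extZero_left {m : ℕ}
    (hd : ∀ Y : ModuleCat.{u} (Module.End R M)ᵐᵒᵖ,
      Module.Finite (Module.End R M)ᵐᵒᵖ Y → HasProjectiveDimensionLE Y (m + 2))
    {X : ModuleCat.{u} R} (hX : Module.Finite R X) (hext : ExtZero m X M) : MemAdd R M X := by
  have hpd : ∀ W : ModuleCat.{u} R, Module.Finite R W → HasProjectiveDimensionLE (homObj M W) m :=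
    fun W hW => hM.projDim_homObj_le_of_extZero hd (k := 0) le_rfl hW fun i hi hi' => by omega
  have key : ∀ (e : ℕ) (W : ModuleCat.{u} R), Module.Finite R W →
      HasProjectiveDimensionLE (homObj M W) e →
      ∀ i, 1 ≤ i → i + e ≤ m → Subsingleton (Abelian.Ext.{u} X W i) := by
    intro e
    induction e with
    | zero =>
      intro W hW h i hi hi'
      exact ext_right_of_memAdd
        ((hM.memAdd_iff_projective hW).2 (projective_iff_projDim_zero.1 h)) (hext i hi hi')
    | succ e ih =>
      intro W hW h i hi hi'
      obtain ⟨W', N, f, g, hW', hN, hs, hF⟩ := hM.exists_approximation_isSES hW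
      have := projective_homObj_of_memAdd hN
      exact hs.ext_right (ext_right_of_memAdd hN (hext i hi (by omega)))
        (ih W' hW' (hF.projDim_left h inferInstance) (i + 1) (by omega) (by omega))
  rcases m with _ | m
  · exact (hM.memAdd_iff_projective hX).2 (projective_iff_projDim_zero.1 (hpd X hX))
  · obtain ⟨X', N, f, g, hX', hN, hs, hF⟩ := hM.exists_approximation_isSES hX
    have := projective_homObj_of_memAdd hN
    obtain ⟨s, hs'⟩ := hs.exists_lift
      (key m X' hX' (hF.projDim_left (hpd X hX) inferInstance) 1 le_rfl (by omega)) (𝟙 X)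
    exact memAdd_of_split hN s g hs'

theorem isNClusterTilting_of_le {m : ℕ} (hgl : globalDim (Module.End R M)ᵐᵒᵖ ≤ (m + 2 : ℕ))
    (hdom : DomDimGE (Module.End R M)ᵐᵒᵖ (m + 2)) : IsNClusterTilting R (m + 1) M := by
  have hd := globalDim_le_iff.1 hgl
  have hMM : ExtZero m M M :=
    hM.unit.extZero_of_dominantGE hM.finite (domDimGE_end_iff.1 hdom)
  refine isNClusterTilting_succ_iff.2 ⟨hM.finite, fun X hX => ⟨fun h i hi hi' =>
    ext_right_of_memAdd h (hMM i hi hi'), fun h => ?_⟩, fun X hX => ⟨fun h i hi hi' =>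
    ext_left_of_memAdd h (hMM i hi hi'), fun h => hM.memAdd_of_extZero_left hd hX h⟩⟩
  exact (hM.memAdd_iff_projective hX).2 (projective_iff_projDim_zero.1
    (hM.projDim_homObj_le_of_extZero hd (by omega) hX h))

theorem dimensions_of_isNClusterTilting {m : ℕ} (hss : ¬ IsSemisimpleRing R)
    (h : IsNClusterTilting R (m + 1) M) :
    globalDim (Module.End R M)ᵐᵒᵖ = (m + 2 : ℕ) ∧ domDim (Module.End R M)ᵐᵒᵖ = (m + 2 : ℕ) := by
  obtain ⟨-, h1, -⟩ := isNClusterTilting_succ_iff.1 h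
  have hself : MemAdd R M M :=
    memAdd_of_split (memAdd_pi M 1) (ModuleCat.ofHom (LinearMap.pi fun _ => LinearMap.id))
      (ModuleCat.ofHom (LinearMap.proj 0)) rfl
  have hMM : ExtZero m M M := (h1 M hM.finite).1 hself
  have hgl : globalDim (Module.End R M)ᵐᵒᵖ ≤ (m + 2 : ℕ) := globalDim_le_iff.2 fun Y hY =>
    hM.projDim_le_add_two (fun X hX => hM.projDim_homObj_le hMM (fun W hW => (h1 W hW).2) m hX
      fun i hi hi' => by omega) hY
  have hdom : DomDimGE (Module.End R M)ᵐᵒᵖ (m + 2) :=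
    domDimGE_end_iff.2 (hM.dominantGE_homObj hM.finite hMM)
  have hsucc : ∀ a : ℕ∞, ((m + 2 : ℕ) : ℕ∞) < a → ((m + 3 : ℕ) : ℕ∞) ≤ a := fun a ha =>
    (ENat.add_one_le_iff (ENat.natCast_ne_top _)).2 ha
  refine ⟨le_antisymm hgl (not_lt.1 fun hlt => hss ?_), le_antisymm (not_lt.1 fun hlt => hss ?_)
    (le_domDim_iff.2 hdom)⟩
  · have hle : globalDim (Module.End R M)ᵐᵒᵖ ≤ (m + 1 : ℕ) := ENat.lt_natCast_add_one_iff.1 hlt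
    exact hM.isSemisimpleRing_of_extZero (globalDim_le_iff.1 hle) le_rfl hMM
  · have hdom' := le_domDim_iff.1 (hsucc _ hlt)
    exact hM.isSemisimpleRing_of_extZero (globalDim_le_iff.1 hgl) (k := m + 1) le_rfl
      (hM.unit.extZero_of_dominantGE hM.finite (domDimGE_end_iff.1 hdom'))

end IsGeneratorCogenerator

end ClusterTilting

/-- **Iyama.** Let `A` be a non-semisimple connected finite-dimensional algebra
over a field `K` (connectedness being expressed by the absence of nontrivial central
idempotents, i.e. `A` is not a product of two nonzero algebras), let `n ≥ 1`, and let `M`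
be a finite-dimensional right `A`-module which is a generator and cogenerator of `mod-A`
(every finite-dimensional projective, resp. injective, right `A`-module lies in `add M`).
Then `M` is an `n`-cluster tilting module if and only if `B = End_A(M)` has global
dimension `n + 1` and dominant dimension `n + 1` (computed on right `B`-modules). -/
theorem isNClusterTilting_iff_end_isHigherAuslander (K : Type u) [Field K] (A : Type u)
    [Ring A] [Algebra K A] [FiniteDimensional K A]
    (hnss : ¬ IsSemisimpleRing A)
    (hconn : ∀ e : A, IsIdempotentElem e → e ∈ Subring.center A → e = 0 ∨ e = 1)
    (n : ℕ) (hn : 1 ≤ n) (M : ModuleCat.{u} Aᵐᵒᵖ) (hfin : Module.Finite Aᵐᵒᵖ M)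
    (hgen : ∀ X : ModuleCat.{u} Aᵐᵒᵖ, Module.Finite Aᵐᵒᵖ X → Module.Projective Aᵐᵒᵖ X →
      MemAdd Aᵐᵒᵖ M X)
    (hcogen : ∀ X : ModuleCat.{u} Aᵐᵒᵖ, Module.Finite Aᵐᵒᵖ X → Module.Injective Aᵐᵒᵖ X →
      MemAdd Aᵐᵒᵖ M X) :
    IsNClusterTilting Aᵐᵒᵖ n M ↔
      (globalDim (Module.End Aᵐᵒᵖ M)ᵐᵒᵖ = (n : ℕ∞) + 1 ∧
        domDim (Module.End Aᵐᵒᵖ M)ᵐᵒᵖ = (n : ℕ∞) + 1) := by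
  have hM : IsGeneratorCogenerator M :=
    { noetherian := isNoetherian_of_tower K inferInstance
      noetherian_end := isNoetherianRing_end_op K hfin
      finite := hfin
      finite_homObj := fun X hX =>
        have := isNoetherian_homObj K hfin hX
        inferInstance
      exists_injective := fun X hX => exists_injective_embedding_finite K hX
      unit := hasUnitDecomposition_of_memAdd (hgen (ModuleCat.of Aᵐᵒᵖ Aᵐᵒᵖ)
        (inferInstanceAs (Module.Finite Aᵐᵒᵖ Aᵐᵒᵖ))
        (inferInstanceAs (Module.Projective Aᵐᵒᵖ Aᵐᵒᵖ)))
      memAdd_of_injective := hcogen }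
  obtain ⟨m, rfl⟩ := Nat.exists_eq_add_of_le' hn
  have hcast : ((m + 1 : ℕ) : ℕ∞) + 1 = (m + 2 : ℕ) := rfl
  rw [hcast]
  constructor
  · exact hM.dimensions_of_isNClusterTilting (mt isSemisimpleRing_mulOpposite_iff.1 hnss)
  · rintro ⟨hgl, hdom⟩
    exact hM.isNClusterTilting_of_le hgl.le (le_domDim_iff.1 hdom.ge)
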